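/- Bochner-type lower bound: if u solves the weighted Monge–Ampère equation, φ := (1/2)(u_{,p} ξ^p + v_q x^q), and σ := |u_{,ijk}|²_g, then at every point of N one has Δ_φ σ ≥ 8 |Ric_φ|²_g, where |Ric_φ|²_g := g^{ip} g^{jq} (Ric_φ)_{ij} (Ric_φ)_{pq}. -/

import Mathlib

open scoped BigOperators
noncomputable section

namespace KRS

variable {n : ℕ}

/-- Partial derivative of `f` in the `i`-th coordinate direction. -/
def pd (i : Fin n) (f : (Fin n → ℝ) → ℝ) : (Fin n → ℝ) → ℝ :=
  fun x => fderiv ℝ f x (Pi.single i 1)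

/-- The Hessian matrix `g(x)` of `u`, with entries `g_{ij} = ∂²u/∂x^i∂x^j`. -/
def hessian (u : (Fin n → ℝ) → ℝ) (x : Fin n → ℝ) : Matrix (Fin n) (Fin n) ℝ :=
  Matrix.of fun i j => pd i (pd j u) x

/-- The inverse matrix `g(x)⁻¹`, with entries `g^{ij}`. -/
def ginv (u : (Fin n → ℝ) → ℝ) (x : Fin n → ℝ) : Matrix (Fin n) (Fin n) ℝ :=
  (hessian u x)⁻¹

/-- Third iterated partial derivative `u_{,ijk}`. -/
def d3 (u : (Fin n → ℝ) → ℝ) (i j k : Fin n) : (Fin n → ℝ) → ℝ :=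
  pd i (pd j (pd k u))

/-- Fourth iterated partial derivative `u_{,ijkl}`. -/
def d4 (u : (Fin n → ℝ) → ℝ) (i j k l : Fin n) : (Fin n → ℝ) → ℝ :=
  pd i (pd j (pd k (pd l u)))

/-- Christoffel symbols `Γ^k_{ij} = (1/2) g^{kl}(∂_i g_{jl} + ∂_j g_{il} − ∂_l g_{ij})`. -/
def Christoffel (u : (Fin n → ℝ) → ℝ) (k i j : Fin n) : (Fin n → ℝ) → ℝ :=
  fun x => (1/2) * ∑ l, ginv u x k l * (d3 u i j l x + d3 u j i l x - d3 u l i j x)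

/-- Riemann curvature tensor
`Rm_{ijkl} = g_{is}(∂_k Γ^s_{lj} − ∂_l Γ^s_{kj} + Γ^s_{kp} Γ^p_{lj} − Γ^s_{lp} Γ^p_{kj})`. -/
def Rm (u : (Fin n → ℝ) → ℝ) (i j k l : Fin n) : (Fin n → ℝ) → ℝ :=
  fun x => ∑ s, hessian u x i s *
    (pd k (Christoffel u s l j) x - pd l (Christoffel u s k j) x
      + ∑ p, Christoffel u s k p x * Christoffel u p l j x
      - ∑ p, Christoffel u s l p x * Christoffel u p k j x)

/-- Ricci tensor `Ric_{ij} = ∂_k Γ^k_{ij} − ∂_j Γ^k_{ik} + Γ^k_{kp} Γ^p_{ij} − Γ^k_{jp} Γ^p_{ik}`. -/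
def Ricci (u : (Fin n → ℝ) → ℝ) (i j : Fin n) : (Fin n → ℝ) → ℝ :=
  fun x => (∑ k, pd k (Christoffel u k i j) x) - (∑ k, pd j (Christoffel u k i k) x)
    + (∑ k, ∑ p, Christoffel u k k p x * Christoffel u p i j x)
    - (∑ k, ∑ p, Christoffel u k j p x * Christoffel u p i k x)

/-- Scalar curvature `s = g^{ij} Ric_{ij}`. -/
def scalarCurv (u : (Fin n → ℝ) → ℝ) : (Fin n → ℝ) → ℝ :=
  fun x => ∑ i, ∑ j, ginv u x i j * Ricci u i j x

/-- Covariant Hessian `(∇²φ)_{ij} = φ_{,ij} − Γ^k_{ij} φ_{,k}`. -/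
def covHess (u φ : (Fin n → ℝ) → ℝ) (i j : Fin n) : (Fin n → ℝ) → ℝ :=
  fun x => pd i (pd j φ) x - ∑ k, Christoffel u k i j x * pd k φ x

/-- Laplace–Beltrami operator `Δφ = g^{ij} (∇²φ)_{ij}`. -/
def laplacian (u φ : (Fin n → ℝ) → ℝ) : (Fin n → ℝ) → ℝ :=
  fun x => ∑ i, ∑ j, ginv u x i j * covHess u φ i j x

/-- Weighted (drift) Laplacian `Δ_φ F = ΔF − g^{ij} φ_{,i} F_{,j}`. -/
def driftLap (u φ F : (Fin n → ℝ) → ℝ) : (Fin n → ℝ) → ℝ :=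
  fun x => laplacian u F x - ∑ i, ∑ j, ginv u x i j * pd i φ x * pd j F x

/-- Bakry–Émery Ricci tensor `(Ric_φ)_{ij} = Ric_{ij} + (∇²φ)_{ij}`. -/
def ricciPhi (u φ : (Fin n → ℝ) → ℝ) (i j : Fin n) : (Fin n → ℝ) → ℝ :=
  fun x => Ricci u i j x + covHess u φ i j x

/-- Pointwise squared `g`-norm of the third derivative tensor:
`|u_{,ijk}|²_g = g^{ip} g^{jq} g^{kr} u_{,ijk} u_{,pqr}`. -/
def norm3 (u : (Fin n → ℝ) → ℝ) : (Fin n → ℝ) → ℝ :=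
  fun x => ∑ i, ∑ j, ∑ k, ∑ p, ∑ q, ∑ r,
    ginv u x i p * ginv u x j q * ginv u x k r * d3 u i j k x * d3 u p q r x

/-- The canonical weight function `φ = (1/2)(u_{,p} ξ^p + v_q x^q)`. -/
def weight (u : (Fin n → ℝ) → ℝ) (ξ v : Fin n → ℝ) : (Fin n → ℝ) → ℝ :=
  fun x => (1/2) * ((∑ p, pd p u x * ξ p) + ∑ q, v q * x q)

/-- `u` solves the weighted Monge–Ampère equation
`log det g(x) = −v_p x^p + u_{,q}(x) ξ^q + c` on `N`. -/
def MAeq (u : (Fin n → ℝ) → ℝ) (N : Set (Fin n → ℝ)) (v ξ : Fin n → ℝ) (c : ℝ) : Prop :=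
  ∀ x ∈ N, Real.log (hessian u x).det = -(∑ p, v p * x p) + (∑ q, pd q u x * ξ q) + c

/-- Covariant derivative of the third derivative tensor:
`(∇T)_{lijk} = u_{,ijkl} − Γ^s_{li} u_{,sjk} − Γ^s_{lj} u_{,isk} − Γ^s_{lk} u_{,ijs}`. -/
def covT (u : (Fin n → ℝ) → ℝ) (l i j k : Fin n) : (Fin n → ℝ) → ℝ :=
  fun x => d4 u i j k l x - (∑ s, Christoffel u s l i x * d3 u s j k x)
    - (∑ s, Christoffel u s l j x * d3 u i s k x)
    - (∑ s, Christoffel u s l k x * d3 u i j s x)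

/-- Completeness of the Hessian metric `g = D²u` on `N`: every C¹ curve
`γ : [0,1) → N` that eventually leaves every compact subset of `N`
has infinite `g`-length. -/
def HessComplete (u : (Fin n → ℝ) → ℝ) (N : Set (Fin n → ℝ)) : Prop :=
  ∀ γ : ℝ → (Fin n → ℝ),
    ContDiffOn ℝ 1 γ (Set.Ico (0:ℝ) 1) →
    (∀ t ∈ Set.Ico (0:ℝ) 1, γ t ∈ N) →
    (∀ K : Set (Fin n → ℝ), IsCompact K → K ⊆ N →
      ∃ tK ∈ Set.Ico (0:ℝ) 1, ∀ t ∈ Set.Ioo tK 1, γ t ∉ K) →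
    ∫⁻ t in Set.Ioo (0:ℝ) 1,
      ENNReal.ofReal (Real.sqrt (∑ i, ∑ j,
        hessian u (γ t) i j * deriv γ t i * deriv γ t j)) = ⊤

section Real

lemma sum_three_equiv {ι : Type*} [Fintype ι] {f g : ι → ι → ι → ℝ}
    (σ : (ι × ι × ι) ≃ (ι × ι × ι))
    (h : ∀ a b c, f a b c = g (σ (a, b, c)).1 (σ (a, b, c)).2.1 (σ (a, b, c)).2.2) :
    ∑ a, ∑ b, ∑ c, f a b c = ∑ a, ∑ b, ∑ c, g a b c := by
  have := Fintype.sum_equiv σ (fun p => f p.1 p.2.1 p.2.2)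
    (fun p => g p.1 p.2.1 p.2.2) (fun p => h _ _ _)
  simpa only [Fintype.sum_prod_type] using this

lemma sum_five_equiv {ι : Type*} [Fintype ι] {f g : ι → ι → ι → ι → ι → ℝ}
    (σ : (ι × ι × ι × ι × ι) ≃ (ι × ι × ι × ι × ι))
    (h : ∀ a b c d e, f a b c d e = g (σ (a, b, c, d, e)).1 (σ (a, b, c, d, e)).2.1
      (σ (a, b, c, d, e)).2.2.1 (σ (a, b, c, d, e)).2.2.2.1 (σ (a, b, c, d, e)).2.2.2.2) :
    ∑ a, ∑ b, ∑ c, ∑ d, ∑ e, f a b c d e = ∑ a, ∑ b, ∑ c, ∑ d, ∑ e, g a b c d e := by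
  have := Fintype.sum_equiv σ
    (fun p => f p.1 p.2.1 p.2.2.1 p.2.2.2.1 p.2.2.2.2)
    (fun p => g p.1 p.2.1 p.2.2.1 p.2.2.2.1 p.2.2.2.2) (fun p => h _ _ _ _ _)
  simpa only [Fintype.sum_prod_type] using this

lemma sum_six_equiv {ι : Type*} [Fintype ι] {f g : ι → ι → ι → ι → ι → ι → ℝ}
    (σ : (ι × ι × ι × ι × ι × ι) ≃ (ι × ι × ι × ι × ι × ι))
    (h : ∀ a b c d e k, f a b c d e k =
      g (σ (a, b, c, d, e, k)).1 (σ (a, b, c, d, e, k)).2.1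
        (σ (a, b, c, d, e, k)).2.2.1 (σ (a, b, c, d, e, k)).2.2.2.1
        (σ (a, b, c, d, e, k)).2.2.2.2.1 (σ (a, b, c, d, e, k)).2.2.2.2.2) :
    ∑ a, ∑ b, ∑ c, ∑ d, ∑ e, ∑ k, f a b c d e k =
      ∑ a, ∑ b, ∑ c, ∑ d, ∑ e, ∑ k, g a b c d e k := by
  have := Fintype.sum_equiv σ
    (fun p => f p.1 p.2.1 p.2.2.1 p.2.2.2.1 p.2.2.2.2.1 p.2.2.2.2.2)
    (fun p => g p.1 p.2.1 p.2.2.1 p.2.2.2.1 p.2.2.2.2.1 p.2.2.2.2.2)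
    (fun p => h _ _ _ _ _ _)
  simpa only [Fintype.sum_prod_type] using this

/-- The full contraction of a quartic form with two copies of a cubic form. -/
def quadQTT (T : Fin n → Fin n → Fin n → ℝ) (Q : Fin n → Fin n → Fin n → Fin n → ℝ) : ℝ :=
  ∑ a, ∑ b, ∑ c, ∑ d, ∑ k, Q a b c d * T a b k * T k c d

/-- The tetrahedral contraction of four copies of a cubic form. -/
def tetraT (T : Fin n → Fin n → Fin n → ℝ) : ℝ :=
  ∑ a, ∑ b, ∑ c, ∑ i, ∑ j, ∑ k, T a b c * T a i j * T b i k * T c j k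

/-- The squared norm of `S_{ab} = T_{acd} T_{bcd}`. -/
def normS (T : Fin n → Fin n → Fin n → ℝ) : ℝ :=
  ∑ a, ∑ b, (Matrix.of (T a) * Matrix.of (T b)).trace ^ 2

/-- The squared norm of a quartic form. -/
def normQ (Q : Fin n → Fin n → Fin n → Fin n → ℝ) : ℝ :=
  ∑ a, ∑ b, ∑ c, ∑ d, Q a b c d ^ 2

variable {T : Fin n → Fin n → Fin n → ℝ} {Q : Fin n → Fin n → Fin n → Fin n → ℝ}

/-- Total symmetry of a cubic form. -/
structure IsSymm3 (T : Fin n → Fin n → Fin n → ℝ) : Prop where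
  left : ∀ a b c, T a b c = T b a c
  right : ∀ a b c, T a b c = T a c b

/-- Total symmetry of a quartic form. -/
structure IsSymm4 (Q : Fin n → Fin n → Fin n → Fin n → ℝ) : Prop where
  left : ∀ a b c d, Q a b c d = Q b a c d
  mid : ∀ a b c d, Q a b c d = Q a c b d
  right : ∀ a b c d, Q a b c d = Q a b d c

lemma sum_T_mul_trace_QT (hT : IsSymm3 T) :
    ∑ a, ∑ b, ∑ c, T c a b * (Matrix.of (Q c a) * Matrix.of (T b)).trace = quadQTT T Q := by
  simp only [Matrix.trace, Matrix.diag_apply, Matrix.mul_apply, Matrix.of_apply, Finset.mul_sum,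
    quadQTT]
  refine sum_five_equiv ⟨fun (a, b, c, d, e) => (c, a, d, e, b),
    fun (c, a, d, e, b) => (a, b, c, d, e), fun _ => rfl, fun _ => rfl⟩ fun a b c d e => ?_
  simp only [Equiv.coe_fn_mk]
  rw [hT.right b e d]
  ring

lemma sum_T_mul_trace_TQ (hT : IsSymm3 T) :
    ∑ a, ∑ b, ∑ c, T c a b * (Matrix.of (T a) * Matrix.of (Q c b)).trace = quadQTT T Q := by
  rw [← sum_T_mul_trace_QT hT, Finset.sum_comm]
  refine Finset.sum_congr rfl fun a _ => Finset.sum_congr rfl fun b _ =>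
    Finset.sum_congr rfl fun c _ => ?_
  rw [Matrix.trace_mul_comm, hT.right c b a]

lemma sum_trace_TQT (hT : IsSymm3 T) (hQ : IsSymm4 Q) :
    ∑ a, ∑ c, (Matrix.of (T c) * Matrix.of (Q c a) * Matrix.of (T a)).trace = quadQTT T Q := by
  simp only [Matrix.trace, Matrix.diag_apply, Matrix.mul_apply, Matrix.of_apply, Finset.sum_mul,
    quadQTT]
  refine sum_five_equiv ⟨fun (a, c, i, j, k) => (c, k, a, j, i),
    fun (c, k, a, j, i) => (a, c, i, j, k), fun _ => rfl, fun _ => rfl⟩ fun a c i j k => ?_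
  simp only [Equiv.coe_fn_mk]
  rw [hT.right c k i, hQ.mid c k a j, hT.left i a j, hT.right a i j]
  ring

lemma sum_trace_TQT' (hT : IsSymm3 T) (hQ : IsSymm4 Q) :
    ∑ a, ∑ c, (Matrix.of (T a) * Matrix.of (Q c a) * Matrix.of (T c)).trace = quadQTT T Q := by
  rw [← sum_trace_TQT hT hQ, Finset.sum_comm]
  refine Finset.sum_congr rfl fun a _ => Finset.sum_congr rfl fun c _ => ?_
  rw [show Q a c = Q c a from funext fun i => funext fun j => hQ.left a c i j]

lemma sum_T_mul_trace_TTT (hT : IsSymm3 T) :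
    ∑ a, ∑ b, ∑ c, T c a b * (Matrix.of (T c) * Matrix.of (T a) * Matrix.of (T b)).trace
      = tetraT T := by
  simp only [Matrix.trace, Matrix.diag_apply, Matrix.mul_apply, Matrix.of_apply, Finset.sum_mul,
    Finset.mul_sum, tetraT]
  refine sum_six_equiv ⟨fun (a, b, c, i, j, k) => (c, a, b, k, i, j),
    fun (c, a, b, k, i, j) => (a, b, c, i, j, k), fun _ => rfl, fun _ => rfl⟩ fun a b c i j k => ?_
  simp only [Equiv.coe_fn_mk]
  rw [hT.right c k i, hT.right b j i]
  ring

lemma sum_T_mul_trace_TTT' (hT : IsSymm3 T) :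
    ∑ a, ∑ b, ∑ c, T c a b * (Matrix.of (T a) * (Matrix.of (T c) * Matrix.of (T b))).trace
      = tetraT T := by
  rw [← sum_T_mul_trace_TTT hT, Finset.sum_comm]
  refine Finset.sum_congr rfl fun a _ => Finset.sum_congr rfl fun b _ =>
    Finset.sum_congr rfl fun c _ => ?_
  rw [Matrix.trace_mul_comm, hT.right c b a]

lemma sum_trace_TTTT (hT : IsSymm3 T) :
    ∑ a, ∑ c, (Matrix.of (T c) * Matrix.of (T a) * (Matrix.of (T c) * Matrix.of (T a))).trace =
      tetraT T := by
  simp only [Matrix.trace, Matrix.diag_apply, Matrix.mul_apply, Matrix.of_apply, Finset.sum_mul,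
    Finset.mul_sum, tetraT]
  refine sum_six_equiv ⟨fun (a, c, i, j, l, m) => (c, i, m, l, j, a),
    fun (c, i, m, l, j, a) => (a, c, i, j, l, m), fun _ => rfl, fun _ => rfl⟩ fun a c i j l m => ?_
  simp only [Equiv.coe_fn_mk]
  rw [hT.left a m j, hT.right m a j, hT.left a l i, hT.right l a i, hT.left l i a, hT.right c j l]
  ring

lemma sum_trace_QQ (hQ : IsSymm4 Q) :
    ∑ a, ∑ c, (Matrix.of (Q c a) * Matrix.of (Q c a)).trace = normQ Q := by
  simp only [Matrix.trace, Matrix.diag_apply, Matrix.mul_apply, Matrix.of_apply, normQ]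
  refine Finset.sum_congr rfl fun a _ => Finset.sum_congr rfl fun c _ =>
    Finset.sum_congr rfl fun i _ => Finset.sum_congr rfl fun j _ => ?_
  rw [hQ.right c a j i, hQ.left c a, sq]

lemma sum_trace_STT (hT : IsSymm3 T) :
    ∑ a, (Matrix.of (fun i j => (Matrix.of (T i) * Matrix.of (T j)).trace) *
      Matrix.of (T a) * Matrix.of (T a)).trace = normS T := by
  have h : ∀ i j, ∑ a, (Matrix.of (T a) * Matrix.of (T a)) i j =
      (Matrix.of (T j) * Matrix.of (T i)).trace := fun i j => by
    simp only [Matrix.mul_apply, Matrix.trace, Matrix.diag_apply, Matrix.of_apply]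
    refine Finset.sum_congr rfl fun a _ => Finset.sum_congr rfl fun k _ => ?_
    rw [hT.left a i k, hT.right a k j, hT.left a j k, mul_comm, hT.right i k a]
  simp only [Matrix.mul_assoc]
  rw [← Matrix.trace_sum, ← Finset.mul_sum, Matrix.trace, normS]
  refine Finset.sum_congr rfl fun i _ => ?_
  rw [Matrix.diag_apply, Matrix.mul_apply]
  refine Finset.sum_congr rfl fun j _ => ?_
  rw [Matrix.sum_apply, h, Matrix.of_apply, sq]

/-- The contraction of `T` with the drift Laplacian of `T` coming from the twice differentiated
equation. -/
lemma sum_trace_lapT_T (hT : IsSymm3 T)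
    {Y : Fin n → Matrix (Fin n) (Fin n) ℝ}
    (hY : ∀ a b c, Y a b c = (Matrix.of (T c) * Matrix.of (Q b a)).trace
      + (Matrix.of (Q c b) * Matrix.of (T a)).trace
      + (Matrix.of (T b) * Matrix.of (Q c a)).trace
      - (Matrix.of (T c) * Matrix.of (T b) * Matrix.of (T a)).trace
      - (Matrix.of (T b) * (Matrix.of (T c) * Matrix.of (T a))).trace) :
    ∑ a, (Y a * Matrix.of (T a)).trace = 3 * quadQTT T Q - 2 * tetraT T := by
  have e1 : ∑ a, ∑ b, ∑ c, T a c b * (Matrix.of (T c) * Matrix.of (Q b a)).trace =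
      quadQTT T Q := by
    rw [← sum_T_mul_trace_TQ hT]
    refine sum_three_equiv ⟨fun (a, b, c) => (c, a, b), fun (c, a, b) => (a, b, c),
      fun _ => rfl, fun _ => rfl⟩ fun a b c => ?_
    simp only [Equiv.coe_fn_mk]
    rw [hT.right a c b, hT.left a b c, hT.right b a c]
  have e2 : ∑ a, ∑ b, ∑ c, T a c b * (Matrix.of (Q c b) * Matrix.of (T a)).trace =
      quadQTT T Q := by
    rw [← sum_T_mul_trace_QT hT]
    refine sum_three_equiv ⟨fun (a, b, c) => (b, a, c), fun (b, a, c) => (a, b, c),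
      fun _ => rfl, fun _ => rfl⟩ fun a b c => ?_
    simp only [Equiv.coe_fn_mk]
    rw [hT.left a c b, hT.right c a b]
  have e3 : ∑ a, ∑ b, ∑ c, T a c b * (Matrix.of (T b) * Matrix.of (Q c a)).trace =
      quadQTT T Q := by
    rw [← sum_T_mul_trace_TQ hT]
    refine sum_three_equiv ⟨fun (a, b, c) => (b, a, c), fun (b, a, c) => (a, b, c),
      fun _ => rfl, fun _ => rfl⟩ fun a b c => ?_
    simp only [Equiv.coe_fn_mk]
    rw [hT.left a c b, hT.right c a b]
  have e4 : ∑ a, ∑ b, ∑ c, T a c b *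
      (Matrix.of (T c) * Matrix.of (T b) * Matrix.of (T a)).trace = tetraT T := by
    rw [← sum_T_mul_trace_TTT hT]
    refine sum_three_equiv ⟨fun (a, b, c) => (b, a, c), fun (b, a, c) => (a, b, c),
      fun _ => rfl, fun _ => rfl⟩ fun a b c => ?_
    simp only [Equiv.coe_fn_mk]
    rw [hT.left a c b, hT.right c a b]
  have e5 : ∑ a, ∑ b, ∑ c, T a c b *
      (Matrix.of (T b) * (Matrix.of (T c) * Matrix.of (T a))).trace = tetraT T := by
    rw [← sum_T_mul_trace_TTT' hT]
    refine sum_three_equiv ⟨fun (a, b, c) => (b, a, c), fun (b, a, c) => (a, b, c),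
      fun _ => rfl, fun _ => rfl⟩ fun a b c => ?_
    simp only [Equiv.coe_fn_mk]
    rw [hT.left a c b, hT.right c a b]
  have key : ∑ a, (Y a * Matrix.of (T a)).trace =
      (∑ a, ∑ b, ∑ c, T a c b * (Matrix.of (T c) * Matrix.of (Q b a)).trace)
      + (∑ a, ∑ b, ∑ c, T a c b * (Matrix.of (Q c b) * Matrix.of (T a)).trace)
      + (∑ a, ∑ b, ∑ c, T a c b * (Matrix.of (T b) * Matrix.of (Q c a)).trace)
      - (∑ a, ∑ b, ∑ c, T a c b *
          (Matrix.of (T c) * Matrix.of (T b) * Matrix.of (T a)).trace)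
      - ∑ a, ∑ b, ∑ c, T a c b *
          (Matrix.of (T b) * (Matrix.of (T c) * Matrix.of (T a))).trace := by
    simp only [← Finset.sum_add_distrib, ← Finset.sum_sub_distrib]
    refine Finset.sum_congr rfl fun a _ => Finset.sum_congr rfl fun b _ => ?_
    rw [Matrix.diag_apply, Matrix.mul_apply]
    refine Finset.sum_congr rfl fun c _ => ?_
    rw [hY, Matrix.of_apply]
    ring
  rw [key, e1, e2, e3, e4, e5]
  ring

lemma normS_eq (T : Fin n → Fin n → Fin n → ℝ) :
    normS T = ∑ a, ∑ b, ∑ c, ∑ k, ∑ d, ∑ l, T a c d * T b d c * (T a k l * T b l k) := by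
  simp only [normS, sq, Matrix.trace, Matrix.diag_apply, Matrix.mul_apply, Matrix.of_apply,
    Finset.sum_mul_sum]

/-- The contraction `T_{abk} T_{kcd}`. -/
def contrT (T : Fin n → Fin n → Fin n → ℝ) (a b c d : Fin n) : ℝ := ∑ k, T a b k * T k c d

lemma sum_contr_sq (hT : IsSymm3 T) :
    ∑ a, ∑ b, ∑ c, ∑ d, contrT T a b c d * contrT T a b c d = normS T := by
  simp only [contrT, Finset.sum_mul_sum, normS_eq]
  refine sum_six_equiv ⟨fun (a, b, c, d, k, l) => (k, l, a, c, b, d),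
    fun (k, l, a, c, b, d) => (a, b, c, d, k, l), fun _ => rfl, fun _ => rfl⟩ fun a b c d k l => ?_
  simp only [Equiv.coe_fn_mk, hT.left, hT.right]
  ring

lemma sum_contr_sq_mid (hT : IsSymm3 T) :
    ∑ a, ∑ b, ∑ c, ∑ d, contrT T a c b d * contrT T a c b d = normS T := by
  rw [← sum_contr_sq hT]
  exact Finset.sum_congr rfl fun a _ => Finset.sum_comm

lemma sum_contr_sq_last (hT : IsSymm3 T) :
    ∑ a, ∑ b, ∑ c, ∑ d, contrT T a d b c * contrT T a d b c = normS T := by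
  simp only [contrT, Finset.sum_mul_sum, normS_eq]
  refine sum_six_equiv ⟨fun (a, b, c, d, k, l) => (k, l, a, b, d, c),
    fun (k, l, a, b, d, c) => (a, b, c, d, k, l), fun _ => rfl, fun _ => rfl⟩ fun a b c d k l => ?_
  simp only [Equiv.coe_fn_mk, hT.left, hT.right]
  ring

lemma sum_contr_mul_mid (hT : IsSymm3 T) :
    ∑ a, ∑ b, ∑ c, ∑ d, contrT T a b c d * contrT T a c b d = tetraT T := by
  simp only [contrT, Finset.sum_mul_sum, tetraT]
  refine sum_six_equiv ⟨fun (a, b, c, d, k, l) => (a, b, k, l, c, d),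
    fun (a, b, k, l, c, d) => (a, b, c, d, k, l), fun _ => rfl, fun _ => rfl⟩ fun a b c d k l => ?_
  simp only [Equiv.coe_fn_mk, hT.left, hT.right]
  ring

lemma sum_contr_mul_last (hT : IsSymm3 T) :
    ∑ a, ∑ b, ∑ c, ∑ d, contrT T a b c d * contrT T a d b c = tetraT T := by
  simp only [contrT, Finset.sum_mul_sum, tetraT]
  refine sum_six_equiv ⟨fun (a, b, c, d, k, l) => (a, b, k, l, d, c),
    fun (a, b, k, l, d, c) => (a, b, c, d, k, l), fun _ => rfl, fun _ => rfl⟩ fun a b c d k l => ?_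
  simp only [Equiv.coe_fn_mk, hT.left, hT.right]
  ring

lemma sum_contr_mid_mul_last (hT : IsSymm3 T) :
    ∑ a, ∑ b, ∑ c, ∑ d, contrT T a c b d * contrT T a d b c = tetraT T := by
  simp only [contrT, Finset.sum_mul_sum, tetraT]
  refine sum_six_equiv ⟨fun (a, b, c, d, k, l) => (a, c, k, l, d, b),
    fun (a, c, k, l, d, b) => (a, b, c, d, k, l), fun _ => rfl, fun _ => rfl⟩ fun a b c d k l => ?_
  simp only [Equiv.coe_fn_mk, hT.left, hT.right]
  ring

lemma sum_Q_mul_contr (T : Fin n → Fin n → Fin n → ℝ) (Q : Fin n → Fin n → Fin n → Fin n → ℝ) :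
    ∑ a, ∑ b, ∑ c, ∑ d, Q a b c d * contrT T a b c d = quadQTT T Q := by
  simp only [contrT, Finset.mul_sum, quadQTT, mul_assoc]

lemma sum_Q_mul_contr_mid (hQ : IsSymm4 Q) :
    ∑ a, ∑ b, ∑ c, ∑ d, Q a b c d * contrT T a c b d = quadQTT T Q := by
  simp only [contrT, Finset.mul_sum, quadQTT, mul_assoc]
  refine sum_five_equiv ⟨fun (a, b, c, d, k) => (a, c, b, d, k),
    fun (a, c, b, d, k) => (a, b, c, d, k), fun _ => rfl, fun _ => rfl⟩ fun a b c d k => ?_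
  simp only [Equiv.coe_fn_mk, hQ.mid a b c d]

lemma sum_Q_mul_contr_last (hQ : IsSymm4 Q) :
    ∑ a, ∑ b, ∑ c, ∑ d, Q a b c d * contrT T a d b c = quadQTT T Q := by
  simp only [contrT, Finset.mul_sum, quadQTT, mul_assoc]
  refine sum_five_equiv ⟨fun (a, b, c, d, k) => (a, d, b, c, k),
    fun (a, d, b, c, k) => (a, b, c, d, k), fun _ => rfl, fun _ => rfl⟩ fun a b c d k => ?_
  simp only [Equiv.coe_fn_mk]
  rw [hQ.right a b c d, hQ.mid a b d c]

lemma tetraT_le_normS (hT : IsSymm3 T) : tetraT T ≤ normS T := by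
  have h : 0 ≤ ∑ a, ∑ b, ∑ c, ∑ d, (contrT T a b c d - contrT T a c b d) ^ 2 := by positivity
  have h2 : ∑ a, ∑ b, ∑ c, ∑ d, (contrT T a b c d - contrT T a c b d) ^ 2 =
      (∑ a, ∑ b, ∑ c, ∑ d, contrT T a b c d * contrT T a b c d)
      + (∑ a, ∑ b, ∑ c, ∑ d, contrT T a c b d * contrT T a c b d)
      - 2 * ∑ a, ∑ b, ∑ c, ∑ d, contrT T a b c d * contrT T a c b d := by
    simp only [Finset.mul_sum, ← Finset.sum_add_distrib, ← Finset.sum_sub_distrib]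
    refine Finset.sum_congr rfl fun a _ => Finset.sum_congr rfl fun b _ =>
      Finset.sum_congr rfl fun c _ => Finset.sum_congr rfl fun d _ => by ring
  rw [h2, sum_contr_sq hT, sum_contr_sq_mid hT, sum_contr_mul_mid hT] at h
  linarith

/-- The nonnegativity of `|Q - (1/2) (T_{abk}T_{kcd} + T_{ack}T_{kbd} + T_{adk}T_{kbc})|²`. -/
lemma normQ_lower_bound (hT : IsSymm3 T) (hQ : IsSymm4 Q) :
    3 * quadQTT T Q ≤ normQ Q + 3 / 4 * normS T + 3 / 2 * tetraT T := by
  have h : 0 ≤ ∑ a, ∑ b, ∑ c, ∑ d,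
      (Q a b c d - 1 / 2 * (contrT T a b c d + contrT T a c b d + contrT T a d b c)) ^ 2 := by
    positivity
  have h2 : ∑ a, ∑ b, ∑ c, ∑ d,
      (Q a b c d - 1 / 2 * (contrT T a b c d + contrT T a c b d + contrT T a d b c)) ^ 2 =
      (∑ a, ∑ b, ∑ c, ∑ d, Q a b c d ^ 2)
      - (∑ a, ∑ b, ∑ c, ∑ d, Q a b c d * contrT T a b c d)
      - (∑ a, ∑ b, ∑ c, ∑ d, Q a b c d * contrT T a c b d)
      - (∑ a, ∑ b, ∑ c, ∑ d, Q a b c d * contrT T a d b c)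
      + 1 / 4 * (∑ a, ∑ b, ∑ c, ∑ d, contrT T a b c d * contrT T a b c d)
      + 1 / 4 * (∑ a, ∑ b, ∑ c, ∑ d, contrT T a c b d * contrT T a c b d)
      + 1 / 4 * (∑ a, ∑ b, ∑ c, ∑ d, contrT T a d b c * contrT T a d b c)
      + 1 / 2 * (∑ a, ∑ b, ∑ c, ∑ d, contrT T a b c d * contrT T a c b d)
      + 1 / 2 * (∑ a, ∑ b, ∑ c, ∑ d, contrT T a b c d * contrT T a d b c)
      + 1 / 2 * (∑ a, ∑ b, ∑ c, ∑ d, contrT T a c b d * contrT T a d b c) := by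
    simp only [Finset.mul_sum, ← Finset.sum_add_distrib, ← Finset.sum_sub_distrib]
    refine Finset.sum_congr rfl fun a _ => Finset.sum_congr rfl fun b _ =>
      Finset.sum_congr rfl fun c _ => Finset.sum_congr rfl fun d _ => by ring
  rw [h2, sum_contr_sq hT, sum_contr_sq_mid hT, sum_contr_sq_last hT, sum_contr_mul_mid hT,
    sum_contr_mul_last hT, sum_contr_mid_mul_last hT, sum_Q_mul_contr, sum_Q_mul_contr_mid hQ,
    sum_Q_mul_contr_last hQ, ← normQ] at h
  linarith

/-- The terms of the drift Laplacian of the squared norm of `T`, in an orthonormal frame. -/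
lemma bochner_expansion (hT : IsSymm3 T) (hQ : IsSymm4 Q)
    {Y : Fin n → Matrix (Fin n) (Fin n) ℝ}
    (hY : ∑ a, (Y a * Matrix.of (T a)).trace = 3 * quadQTT T Q - 2 * tetraT T) :
    (∑ a, ∑ b, (Matrix.of (T a) * Matrix.of (T b)).trace *
        (Matrix.of (T a) * Matrix.of (T b)).trace)
      + (2 * ∑ a, ((Matrix.of (fun i j => (Matrix.of (T i) * Matrix.of (T j)).trace)
            * Matrix.of (T a) + Y a
            - (2 : ℝ) • ∑ c, Matrix.of (T c) * Matrix.of (Q c a)) * Matrix.of (T a)).trace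
        + 2 * ∑ a, (∑ c, (Matrix.of (Q c a) - Matrix.of (T c) * Matrix.of (T a)) *
            (Matrix.of (Q c a) - Matrix.of (T c) * Matrix.of (T a))).trace)
      + ∑ a, ∑ b, 2 * ∑ c, -T c a b *
          (((Matrix.of (Q c a) - Matrix.of (T c) * Matrix.of (T a)) * Matrix.of (T b)).trace
          + (Matrix.of (T a) * (Matrix.of (Q c b) - Matrix.of (T c) * Matrix.of (T b))).trace)
      = 3 * normS T + 2 * normQ Q - 6 * quadQTT T Q + 2 * tetraT T := by
  have e1 : ∑ a, ∑ b, (Matrix.of (T a) * Matrix.of (T b)).trace *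
      (Matrix.of (T a) * Matrix.of (T b)).trace = normS T := by
    simp only [normS, sq]
  have e2 : ∑ a, ((Matrix.of (fun i j => (Matrix.of (T i) * Matrix.of (T j)).trace)
      * Matrix.of (T a) + Y a
      - (2 : ℝ) • ∑ c, Matrix.of (T c) * Matrix.of (Q c a)) * Matrix.of (T a)).trace =
      normS T + (3 * quadQTT T Q - 2 * tetraT T) - 2 * quadQTT T Q := by
    rw [← hY, ← sum_trace_STT hT, ← sum_trace_TQT hT hQ, Finset.mul_sum,
      ← Finset.sum_add_distrib, ← Finset.sum_sub_distrib]
    refine Finset.sum_congr rfl fun a _ => ?_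
    rw [Matrix.sub_mul, Matrix.add_mul, Matrix.trace_sub, Matrix.trace_add, Matrix.smul_mul,
      Matrix.trace_smul, Matrix.sum_mul, Matrix.trace_sum, smul_eq_mul]
  have e3 : ∑ a, (∑ c, (Matrix.of (Q c a) - Matrix.of (T c) * Matrix.of (T a)) *
      (Matrix.of (Q c a) - Matrix.of (T c) * Matrix.of (T a))).trace =
      normQ Q - 2 * quadQTT T Q + tetraT T := by
    rw [← sum_trace_QQ hQ, ← sum_trace_TQT' hT hQ, ← sum_trace_TTTT hT, Finset.mul_sum,
      ← Finset.sum_sub_distrib, ← Finset.sum_add_distrib]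
    refine Finset.sum_congr rfl fun a _ => ?_
    rw [Matrix.trace_sum, Finset.mul_sum, ← Finset.sum_sub_distrib, ← Finset.sum_add_distrib]
    refine Finset.sum_congr rfl fun c _ => ?_
    rw [Matrix.sub_mul, Matrix.mul_sub, Matrix.mul_sub, Matrix.trace_sub, Matrix.trace_sub,
      Matrix.trace_sub, ← Matrix.mul_assoc (Matrix.of (Q c a)), Matrix.trace_mul_comm _
      (Matrix.of (T a)), ← Matrix.mul_assoc (Matrix.of (T a)),
      Matrix.trace_mul_cycle (Matrix.of (T c)), Matrix.trace_mul_cycle (Matrix.of (Q c a))]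
    ring
  have e4 : ∑ a, ∑ b, 2 * ∑ c, -T c a b *
      (((Matrix.of (Q c a) - Matrix.of (T c) * Matrix.of (T a)) * Matrix.of (T b)).trace
      + (Matrix.of (T a) * (Matrix.of (Q c b) - Matrix.of (T c) * Matrix.of (T b))).trace) =
      -2 * quadQTT T Q - 2 * quadQTT T Q + 2 * tetraT T + 2 * tetraT T := by
    nth_rw 1 [← sum_T_mul_trace_QT hT]
    nth_rw 1 [← sum_T_mul_trace_TQ hT]
    nth_rw 1 [← sum_T_mul_trace_TTT hT]
    rw [← sum_T_mul_trace_TTT' hT]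
    simp only [Finset.mul_sum, ← Finset.sum_add_distrib, ← Finset.sum_sub_distrib]
    refine Finset.sum_congr rfl fun a _ => Finset.sum_congr rfl fun b _ =>
      Finset.sum_congr rfl fun c _ => ?_
    rw [Matrix.sub_mul, Matrix.mul_sub, Matrix.trace_sub, Matrix.trace_sub]
    ring
  rw [e1, e2, e3, e4]
  ring

end Real

section Algebra

lemma ev_trace {A : Type*} [CommRing A] (ev : A →+* ℝ) (M : Matrix (Fin n) (Fin n) A) :
    ev M.trace = (ev.mapMatrix M).trace :=
  AddMonoidHom.map_trace ev M

variable {A : Type*} [CommRing A] [Algebra ℝ A]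

lemma map_derivation_mul (d : Derivation ℝ A A) (M N : Matrix (Fin n) (Fin n) A) :
    (M * N).map d = M.map d * N + M * N.map d := by
  ext i j
  simp only [Matrix.map_apply, Matrix.mul_apply, map_sum, Derivation.leibniz, smul_eq_mul,
    Matrix.add_apply, ← Finset.sum_add_distrib]
  exact Finset.sum_congr rfl fun k _ => by ring

lemma derivation_trace (d : Derivation ℝ A A) (M : Matrix (Fin n) (Fin n) A) :
    d M.trace = (M.map d).trace := by
  simp [Matrix.trace]

lemma map_derivation_one (d : Derivation ℝ A A) :
    (1 : Matrix (Fin n) (Fin n) A).map d = 0 := by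
  ext i j
  by_cases hij : i = j <;> simp [hij]

lemma map_derivation_of_mul_eq_one (d : Derivation ℝ A A) {K h : Matrix (Fin n) (Fin n) A}
    (hK : K * h = 1) : K.map d = -(K * h.map d * K) := by
  have h1 := map_derivation_mul d K h
  rw [hK, map_derivation_one] at h1
  have h2 : h * K = 1 := mul_eq_one_comm.mp hK
  calc K.map d = K.map d * (h * K) := by rw [h2, mul_one]
    _ = (K.map d * h + K * h.map d) * K - K * h.map d * K := by noncomm_ring
    _ = _ := by rw [← h1]; noncomm_ring

lemma derivation_prod (d : Derivation ℝ A A) {ι : Type*} [DecidableEq ι] (s : Finset ι)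
    (f : ι → A) : d (∏ i ∈ s, f i) = ∑ i ∈ s, (∏ j ∈ s.erase i, f j) * d (f i) := by
  induction s using Finset.induction_on with
  | empty => simp
  | insert a s ha ih =>
    rw [Finset.prod_insert ha, Derivation.leibniz, ih, Finset.sum_insert ha,
      Finset.erase_insert ha, smul_eq_mul, smul_eq_mul, Finset.mul_sum, add_comm]
    congr 1
    refine Finset.sum_congr rfl fun i hi => ?_
    have hai : a ≠ i := fun e => ha (e ▸ hi)
    rw [Finset.erase_insert_of_ne hai, Finset.prod_insert (by simp [ha])]
    ring

/-- Jacobi's formula for a derivation. -/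
lemma derivation_det (d : Derivation ℝ A A) (M : Matrix (Fin n) (Fin n) A) :
    d M.det = (M.adjugate * M.map d).trace := by
  have hcol : ∀ i, (M.adjugate * M.map d) i i = (M.updateCol i fun k => d (M k i)).det := by
    intro i
    rw [← Matrix.cramer_apply, Matrix.cramer_eq_adjugate_mulVec]
    rfl
  simp only [Matrix.trace, Matrix.diag_apply, hcol, Matrix.det_apply, map_sum]
  rw [Finset.sum_comm]
  refine Finset.sum_congr rfl fun σ _ => ?_
  rw [Units.smul_def, Derivation.map_smul_of_tower, derivation_prod, Finset.smul_sum]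
  refine Finset.sum_congr rfl fun i _ => ?_
  rw [Units.smul_def, ← Finset.prod_erase_mul _ _ (Finset.mem_univ i)]
  congr 2
  · exact Finset.prod_congr rfl fun j hj => by
      rw [Matrix.updateCol_ne (Finset.ne_of_mem_erase hj)]
  · rw [Matrix.updateCol_self]

/-- The drift Laplacian of a family of derivations `D` (an orthonormal frame) and a drift `Z`. -/
def frameLap (D : Fin n → Derivation ℝ A A) (Z : Derivation ℝ A A) : A →ₗ[ℝ] A :=
  ∑ c, (D c).toLinearMap ∘ₗ (D c).toLinearMap - Z.toLinearMap

variable (D : Fin n → Derivation ℝ A A) (Z : Derivation ℝ A A)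

lemma frameLap_apply (f : A) : frameLap D Z f = ∑ c, D c (D c f) - Z f := by
  simp [frameLap]

lemma frameLap_mul (f g : A) : frameLap D Z (f * g) =
    frameLap D Z f * g + f * frameLap D Z g + 2 * ∑ c, D c f * D c g := by
  have h : ∑ c, D c (D c (f * g)) =
      (∑ c, D c (D c f)) * g + f * ∑ c, D c (D c g) + 2 * ∑ c, D c f * D c g := by
    simp only [Finset.sum_mul, Finset.mul_sum, ← Finset.sum_add_distrib]
    refine Finset.sum_congr rfl fun c _ => ?_
    simp only [Derivation.leibniz, map_add, smul_eq_mul]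
    ring
  rw [frameLap_apply, frameLap_apply, frameLap_apply, h, Derivation.leibniz, smul_eq_mul,
    smul_eq_mul]
  ring

lemma map_frameLap_mul (M N : Matrix (Fin n) (Fin n) A) : (M * N).map (frameLap D Z) =
    M.map (frameLap D Z) * N + M * N.map (frameLap D Z)
      + (2 : A) • ∑ c, M.map (D c) * N.map (D c) := by
  ext i j
  simp only [Matrix.map_apply, Matrix.mul_apply, map_sum, frameLap_mul, Matrix.add_apply,
    Matrix.smul_apply, Matrix.sum_apply, smul_eq_mul, Finset.sum_add_distrib, ← Finset.mul_sum]
  rw [Finset.sum_comm (f := fun k c => D c (M i k) * D c (N k j))]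

lemma frameLap_trace (M : Matrix (Fin n) (Fin n) A) :
    frameLap D Z M.trace = (M.map (frameLap D Z)).trace := by
  simp [Matrix.trace]

lemma map_frameLap_one : (1 : Matrix (Fin n) (Fin n) A).map (frameLap D Z) = 0 := by
  ext i j
  by_cases hij : i = j <;> simp [hij, frameLap_apply]

variable (u : A)

/-- The Hessian matrix of `u` in the frame `D`. -/
def frameHess : Matrix (Fin n) (Fin n) A := Matrix.of fun a b => D a (D b u)

variable (ev : A →+* ℝ)

/-- Evaluated third derivatives of `u` in the frame `D`. -/
def evT (a b c : Fin n) : ℝ := ev (D a (D b (D c u)))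

/-- Evaluated fourth derivatives of `u` in the frame `D`. -/
def evQ (a b c d : Fin n) : ℝ := ev (D a (D b (D c (D d u))))

variable {D Z u ev} {K : Matrix (Fin n) (Fin n) A}

lemma mapMatrix_hess_one (a : Fin n) :
    ev.mapMatrix ((frameHess D u).map (D a)) = Matrix.of (evT D u ev a) := by
  ext b c
  rfl

lemma mapMatrix_hess_two (a b : Fin n) :
    ev.mapMatrix (((frameHess D u).map (D b)).map (D a)) = Matrix.of (evQ D u ev a b) := by
  ext c d
  rfl

lemma mapMatrix_inv_one (hK : K * frameHess D u = 1) (hev : ev.mapMatrix K = 1) (c : Fin n) :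
    ev.mapMatrix (K.map (D c)) = -Matrix.of (evT D u ev c) := by
  rw [map_derivation_of_mul_eq_one (D c) hK]
  simp only [map_neg, map_mul, hev, mapMatrix_hess_one, one_mul, mul_one]

lemma mapMatrix_log_one (hK : K * frameHess D u = 1) (hev : ev.mapMatrix K = 1) (a c : Fin n) :
    ev.mapMatrix ((K * (frameHess D u).map (D a)).map (D c)) =
      Matrix.of (evQ D u ev c a) - Matrix.of (evT D u ev c) * Matrix.of (evT D u ev a) := by
  rw [map_derivation_mul]
  simp only [map_add, map_mul, hev, mapMatrix_hess_one, mapMatrix_hess_two,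
    mapMatrix_inv_one hK hev, one_mul]
  noncomm_ring

lemma map_log_one (hK : K * frameHess D u = 1) (a b : Fin n) :
    (K * (frameHess D u).map (D a)).map (D b) = K * ((frameHess D u).map (D a)).map (D b) -
      (K * (frameHess D u).map (D b)) * (K * (frameHess D u).map (D a)) := by
  rw [map_derivation_mul, map_derivation_of_mul_eq_one (D b) hK]
  noncomm_ring

lemma isSymm3_evT (hD : ∀ a b f, D a (D b f) = D b (D a f)) : IsSymm3 (evT D u ev) where
  left a b c := by simp only [evT, hD a b]
  right a b c := by simp only [evT, hD b c]

lemma isSymm4_evQ (hD : ∀ a b f, D a (D b f) = D b (D a f)) : IsSymm4 (evQ D u ev) where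
  left a b c d := by simp only [evQ, hD a b]
  mid a b c d := by simp only [evQ, hD b c]
  right a b c d := by simp only [evQ, hD c d]

/-- Evaluation of the equation `tr (K · D_a h) = const + Z (D_a u)`, differentiated once. -/
lemma ev_frameLap_hess (hD : ∀ a b f, D a (D b f) = D b (D a f))
    (hZ : ∀ a f, D a (Z f) = Z (D a f))
    (hK : K * frameHess D u = 1) (hev : ev.mapMatrix K = 1)
    (hMA : ∀ a b, D b (K * (frameHess D u).map (D a)).trace = D b (Z (D a u))) :
    ev.mapMatrix ((frameHess D u).map (frameLap D Z)) =
      Matrix.of fun a b => (Matrix.of (evT D u ev a) * Matrix.of (evT D u ev b)).trace := by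
  ext a b
  have h := congrArg ev (hMA b a)
  rw [derivation_trace, ev_trace, mapMatrix_log_one hK hev, Matrix.trace_sub, hZ] at h
  have h2 : (Matrix.of (evQ D u ev a b)).trace = ev (∑ c, D c (D c (D a (D b u)))) := by
    rw [map_sum]
    refine Finset.sum_congr rfl fun c _ => congrArg ev ?_
    rw [hD b c, hD a c, hD b c, hD a c]
  rw [h2] at h
  simp only [RingHom.mapMatrix_apply, Matrix.map_apply, frameHess, Matrix.of_apply,
    frameLap_apply, map_sub]
  linarith

/-- Evaluation of the equation `tr (K · D_a h) = const + Z (D_a u)`, differentiated twice. -/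
lemma ev_frameLap_third (hD : ∀ a b f, D a (D b f) = D b (D a f))
    (hZ : ∀ a f, D a (Z f) = Z (D a f))
    (hK : K * frameHess D u = 1) (hev : ev.mapMatrix K = 1)
    (hMA : ∀ a b, D b (K * (frameHess D u).map (D a)).trace = D b (Z (D a u))) (a b c : Fin n) :
    ev.mapMatrix (((frameHess D u).map (D a)).map (frameLap D Z)) b c =
      (Matrix.of (evT D u ev c) * Matrix.of (evQ D u ev b a)).trace
      + (Matrix.of (evQ D u ev c b) * Matrix.of (evT D u ev a)).trace
      + (Matrix.of (evT D u ev b) * Matrix.of (evQ D u ev c a)).trace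
      - (Matrix.of (evT D u ev c) * Matrix.of (evT D u ev b) * Matrix.of (evT D u ev a)).trace
      - (Matrix.of (evT D u ev b) *
          (Matrix.of (evT D u ev c) * Matrix.of (evT D u ev a))).trace := by
  have h := congrArg ev (congrArg (D c) (hMA a b))
  rw [derivation_trace, map_log_one hK, derivation_trace, ev_trace,
    Matrix.map_sub (hf := map_sub (D c)), map_sub, map_derivation_mul, map_derivation_mul] at h
  simp only [map_add, map_mul, mapMatrix_log_one hK hev, hev, mapMatrix_hess_one,
    mapMatrix_hess_two, mapMatrix_inv_one hK hev, one_mul, Matrix.trace_sub, Matrix.trace_add,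
    Matrix.sub_mul, Matrix.mul_sub, Matrix.neg_mul, Matrix.trace_neg, hZ] at h
  have h2 : (ev.mapMatrix ((((frameHess D u).map (D a)).map (D b)).map (D c))).trace =
      ev (∑ d, D d (D d (D a (D b (D c u))))) := by
    rw [map_sum]
    refine Finset.sum_congr rfl fun d _ => congrArg ev ?_
    change D c (D b (D a (D d (D d u)))) = _
    rw [hD a d, hD a d, hD b d, hD c d, hD b d, hD c d, hD b a, hD c a, hD c b]
  rw [h2, hD b a u, hD c a, hD c b] at h
  simp only [RingHom.mapMatrix_apply, Matrix.map_apply, frameHess, Matrix.of_apply,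
    frameLap_apply, map_sub]
  linarith

lemma ev_frameLap_inv (hD : ∀ a b f, D a (D b f) = D b (D a f))
    (hZ : ∀ a f, D a (Z f) = Z (D a f))
    (hK : K * frameHess D u = 1) (hev : ev.mapMatrix K = 1)
    (hMA : ∀ a b, D b (K * (frameHess D u).map (D a)).trace = D b (Z (D a u))) :
    ev.mapMatrix (K.map (frameLap D Z)) =
      Matrix.of fun a b => (Matrix.of (evT D u ev a) * Matrix.of (evT D u ev b)).trace := by
  have hev' : ev.mapMatrix (frameHess D u) = 1 := by
    have := congrArg ev.mapMatrix hK
    rwa [map_mul, hev, one_mul, map_one] at this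
  have h := congrArg ev.mapMatrix (map_frameLap_mul D Z K (frameHess D u))
  rw [hK, map_frameLap_one, two_smul] at h
  simp only [map_add, map_mul, map_sum, map_zero, hev, hev', mul_one, one_mul,
    ev_frameLap_hess hD hZ hK hev hMA, mapMatrix_inv_one hK hev, mapMatrix_hess_one] at h
  have h2 : ∑ c, -Matrix.of (evT D u ev c) * Matrix.of (evT D u ev c) =
      -Matrix.of fun a b => (Matrix.of (evT D u ev a) * Matrix.of (evT D u ev b)).trace := by
    have hT := isSymm3_evT (u := u) (ev := ev) hD
    ext a b
    simp only [Matrix.sum_apply, Matrix.neg_mul, Matrix.neg_apply, Matrix.mul_apply,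
      Matrix.of_apply, Matrix.trace, Matrix.diag_apply, Finset.sum_neg_distrib]
    refine congrArg Neg.neg (Finset.sum_congr rfl fun c _ => Finset.sum_congr rfl fun d _ => ?_)
    rw [hT.left c a d, hT.right c d b, hT.left c b d, hT.right b c d]
  rw [h2] at h
  ext a b
  have h3 := congrFun (congrFun h a) b
  simp only [Matrix.zero_apply, Matrix.add_apply, Matrix.neg_apply] at h3
  linarith

/-- The squared norm of the third derivatives of `u`. -/
def frameNorm (K h : Matrix (Fin n) (Fin n) A) (D : Fin n → Derivation ℝ A A) : A :=
  ∑ a, ∑ b, K a b * ((K * h.map (D a)) * (K * h.map (D b))).trace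

lemma ev_frameLap_log (hK : K * frameHess D u = 1) (hev : ev.mapMatrix K = 1) (a : Fin n) :
    ev.mapMatrix ((K * (frameHess D u).map (D a)).map (frameLap D Z)) =
      ev.mapMatrix (K.map (frameLap D Z)) * Matrix.of (evT D u ev a)
      + ev.mapMatrix (((frameHess D u).map (D a)).map (frameLap D Z))
      - (2 : ℝ) • ∑ c, Matrix.of (evT D u ev c) * Matrix.of (evQ D u ev c a) := by
  rw [map_frameLap_mul, two_smul, two_smul]
  simp only [map_add, map_mul, map_sum, hev, one_mul, mapMatrix_inv_one hK hev,
    mapMatrix_hess_one, mapMatrix_hess_two, Matrix.neg_mul, Finset.sum_neg_distrib]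
  abel

/-- The Bochner-type lower bound for the squared norm of the third derivatives, in a frame which
is orthonormal at the evaluation point. -/
lemma half_normS_le_frameLap_norm (hD : ∀ a b f, D a (D b f) = D b (D a f))
    (hZ : ∀ a f, D a (Z f) = Z (D a f))
    (hK : K * frameHess D u = 1) (hev : ev.mapMatrix K = 1)
    (hMA : ∀ a b, D b (K * (frameHess D u).map (D a)).trace = D b (Z (D a u))) :
    1 / 2 * normS (evT D u ev) ≤ ev (frameLap D Z (frameNorm K (frameHess D u) D)) := by
  have hK1 : ∀ a b, ev (K a b) = if a = b then 1 else 0 := fun a b => by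
    have := congrFun (congrFun hev a) b
    rwa [Matrix.one_apply] at this
  have hdK : ∀ a b c, ev (D c (K a b)) = -evT D u ev c a b := fun a b c =>
    congrFun (congrFun (mapMatrix_inv_one hK hev c) a) b
  have hLK : ∀ a b, ev (frameLap D Z (K a b)) =
      (Matrix.of (evT D u ev a) * Matrix.of (evT D u ev b)).trace := fun a b =>
    congrFun (congrFun (ev_frameLap_inv hD hZ hK hev hMA) a) b
  have hLP := ev_frameLap_log (Z := Z) hK hev
  simp only [ev_frameLap_inv hD hZ hK hev hMA] at hLP
  have hT := isSymm3_evT (u := u) (ev := ev) hD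
  have hQ := isSymm4_evQ (u := u) (ev := ev) hD
  have hL : ev (frameLap D Z (frameNorm K (frameHess D u) D)) = 3 * normS (evT D u ev)
      + 2 * normQ (evQ D u ev) - 6 * quadQTT (evT D u ev) (evQ D u ev)
      + 2 * tetraT (evT D u ev) := by
    rw [← bochner_expansion hT hQ
      (sum_trace_lapT_T hT (ev_frameLap_third hD hZ hK hev hMA))]
    simp only [frameNorm, map_sum, frameLap_mul, map_add, map_mul, hK1, hdK, derivation_trace,
      frameLap_trace, map_frameLap_mul _ _ (K * _) (K * _), hLP,
      map_derivation_mul _ (K * _) (K * _), ev_trace, hLK,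
      mapMatrix_log_one hK hev, hev, mapMatrix_hess_one, one_mul, ite_mul, zero_mul, two_smul A,
      Finset.sum_add_distrib, Finset.sum_ite_eq, Finset.mem_univ, if_true,
      Matrix.trace_add, two_mul (∑ a, _)]
    simp only [Matrix.trace_mul_comm (Matrix.of _) (_ + _ - _)]
  rw [hL]
  linarith [normQ_lower_bound hT hQ, tetraT_le_normS hT]

end Algebra

section Coordinates

variable {A : Type*} [CommRing A] [Algebra ℝ A]

/-- The Christoffel symbols of the Hessian metric `h` with inverse `G`. -/
def frameChristoffel (G h : Matrix (Fin n) (Fin n) A) (P : Fin n → Derivation ℝ A A)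
    (k i j : Fin n) : A :=
  (1 / 2 : ℝ) • (G * h.map (P i)) k j

variable {P : Fin n → Derivation ℝ A A} {U : A} {G : Matrix (Fin n) (Fin n) A}
  {ev : A →ₐ[ℝ] ℝ}

lemma ev_frameChristoffel (k i j : Fin n) :
    ev (frameChristoffel G (frameHess P U) P k i j) =
      1 / 2 * (ev.toRingHom.mapMatrix G * Matrix.of (evT P U ev.toRingHom i)) k j := by
  rw [frameChristoffel, map_smul, smul_eq_mul, ← mapMatrix_hess_one, ← map_mul]
  rfl

lemma ev_frameNorm : ev (frameNorm G (frameHess P U) P) =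
    ∑ a, ∑ b, ev.toRingHom.mapMatrix G a b *
      (ev.toRingHom.mapMatrix G * Matrix.of (evT P U ev.toRingHom a)
        * (ev.toRingHom.mapMatrix G * Matrix.of (evT P U ev.toRingHom b))).trace := by
  simp only [frameNorm, map_sum, map_mul]
  refine Finset.sum_congr rfl fun a _ => Finset.sum_congr rfl fun b _ => ?_
  rw [← mapMatrix_hess_one, ← mapMatrix_hess_one,
    ← map_mul ev.toRingHom.mapMatrix, ← map_mul ev.toRingHom.mapMatrix,
    ← map_mul ev.toRingHom.mapMatrix]
  exact congrArg (ev (G a b) * ·) (AddMonoidHom.map_trace ev.toRingHom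
    (G * (frameHess P U).map (P a) * (G * (frameHess P U).map (P b))))

lemma sum_mul_trace_eq {γ : Matrix (Fin n) (Fin n) ℝ} {T : Fin n → Fin n → Fin n → ℝ}
    (hγ : ∀ i j, γ i j = γ j i) (hT : IsSymm3 T) :
    ∑ i, ∑ j, ∑ k, ∑ p, ∑ q, ∑ r, γ i p * γ j q * γ k r * T i j k * T p q r =
      ∑ a, ∑ b, γ a b * (γ * Matrix.of (T a) * (γ * Matrix.of (T b))).trace := by
  simp only [Matrix.trace, Matrix.diag_apply, Matrix.mul_apply, Matrix.of_apply,
    Finset.mul_sum, Finset.sum_mul]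
  refine sum_six_equiv ⟨fun (i, j, k, p, q, r) => (i, p, q, k, r, j),
    fun (i, p, q, k, r, j) => (i, j, k, p, q, r), fun _ => rfl, fun _ => rfl⟩
    fun i j k p q r => ?_
  simp only [Equiv.coe_fn_mk]
  rw [hγ j q, hT.right p q r]
  ring

lemma ev_derivation_frameChristoffel (hG : G * frameHess P U = 1) (l k i j : Fin n) :
    ev (P l (frameChristoffel G (frameHess P U) P k i j)) =
      1 / 2 * ((ev.toRingHom.mapMatrix G * Matrix.of (evQ P U ev.toRingHom l i)) k j
        - (ev.toRingHom.mapMatrix G * Matrix.of (evT P U ev.toRingHom l)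
          * (ev.toRingHom.mapMatrix G * Matrix.of (evT P U ev.toRingHom i))) k j) := by
  rw [frameChristoffel, Derivation.map_smul, map_smul, smul_eq_mul, ← Matrix.sub_apply,
    ← mapMatrix_hess_one, ← mapMatrix_hess_one, ← mapMatrix_hess_two]
  simp only [← map_mul, ← map_sub]
  rw [← map_log_one hG]
  rfl

lemma ev_trace_log {v ξ : Fin n → ℝ}
    (hMA : ∀ i, (G * (frameHess P U).map (P i)).trace =
      ∑ q, ξ q • P i (P q U) - algebraMap ℝ A (v i)) (k : Fin n) :
    (ev.toRingHom.mapMatrix G * Matrix.of (evT P U ev.toRingHom k)).trace =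
      ∑ q, ξ q * ev (P k (P q U)) - v k := by
  have := congrArg ev (hMA k)
  rw [map_sub, map_sum, AlgHom.commutes] at this
  simp only [map_smul, smul_eq_mul] at this
  rw [show algebraMap ℝ ℝ (v k) = v k from rfl] at this
  rw [← this, ← mapMatrix_hess_one, ← map_mul, ← ev_trace]
  rfl

lemma ev_derivation_weight {v ξ : Fin n → ℝ} {W : A}
    (hW : ∀ k, P k W = (1 / 2 : ℝ) • (∑ p, ξ p • P k (P p U) + algebraMap ℝ A (v k)))
    (hMA : ∀ i, (G * (frameHess P U).map (P i)).trace =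
      ∑ q, ξ q • P i (P q U) - algebraMap ℝ A (v i)) (k : Fin n) :
    ev (P k W) = ∑ p, ξ p * ev (P k (P p U)) -
      1 / 2 * (ev.toRingHom.mapMatrix G * Matrix.of (evT P U ev.toRingHom k)).trace := by
  rw [ev_trace_log hMA, hW, map_smul, map_add, map_sum, AlgHom.commutes]
  simp only [map_smul, smul_eq_mul]
  rw [show algebraMap ℝ ℝ (v k) = v k from rfl]
  ring

variable {γ : Matrix (Fin n) (Fin n) ℝ} {T : Fin n → Fin n → Fin n → ℝ}
  {Q : Fin n → Fin n → Fin n → Fin n → ℝ}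

lemma sum_mul_apply_self (hT : IsSymm3 T) (p : Fin n) :
    ∑ k, (γ * Matrix.of (T k)) k p = (γ * Matrix.of (T p)).trace := by
  simp only [Matrix.mul_apply, Matrix.trace, Matrix.diag_apply, Matrix.of_apply]
  refine Finset.sum_congr rfl fun k _ => Finset.sum_congr rfl fun l _ => ?_
  rw [hT.right k l p, hT.left k p l, hT.right p k l]

lemma sum_mul_apply_self_four (hQ : IsSymm4 Q) (i p : Fin n) :
    ∑ k, (γ * Matrix.of (Q k i)) k p = (γ * Matrix.of (Q p i)).trace := by
  simp only [Matrix.mul_apply, Matrix.trace, Matrix.diag_apply, Matrix.of_apply]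
  refine Finset.sum_congr rfl fun k _ => Finset.sum_congr rfl fun l _ => ?_
  rw [hQ.right k i l p, hQ.mid k i p l, hQ.left k p i l, hQ.mid p k i l, hQ.right p i k l]

lemma sum_mul_mul_apply_self (hT : IsSymm3 T) (M : Matrix (Fin n) (Fin n) ℝ) (j : Fin n) :
    ∑ k, (γ * Matrix.of (T k) * M) k j = ∑ p, (γ * Matrix.of (T p)).trace * M p j := by
  simp only [← sum_mul_apply_self (γ := γ) hT, Finset.sum_mul]
  rw [Finset.sum_comm]
  exact Finset.sum_congr rfl fun k _ => Matrix.mul_apply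

/-- The Bakry–Émery Ricci tensor of a solution of the weighted Monge–Ampère equation is
`(1/4) tr (G h_i G h_j)`. -/
lemma ev_ricciPhi (hP : ∀ a b f, P a (P b f) = P b (P a f)) (hG : G * frameHess P U = 1)
    {v ξ : Fin n → ℝ} {W : A}
    (hW : ∀ k, P k W = (1 / 2 : ℝ) • (∑ p, ξ p • P k (P p U) + algebraMap ℝ A (v k)))
    (hMA : ∀ i, (G * (frameHess P U).map (P i)).trace =
      ∑ q, ξ q • P i (P q U) - algebraMap ℝ A (v i)) (i j : Fin n) :
    ev (∑ k, P k (frameChristoffel G (frameHess P U) P k i j)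
      - ∑ k, P j (frameChristoffel G (frameHess P U) P k i k)
      + ∑ k, ∑ p, frameChristoffel G (frameHess P U) P k k p
          * frameChristoffel G (frameHess P U) P p i j
      - ∑ k, ∑ p, frameChristoffel G (frameHess P U) P k j p
          * frameChristoffel G (frameHess P U) P p i k
      + (P i (P j W) - ∑ k, frameChristoffel G (frameHess P U) P k i j * P k W)) =
    1 / 4 * ev ((G * (frameHess P U).map (P i)) * (G * (frameHess P U).map (P j))).trace := by
  have hT := isSymm3_evT (u := U) (ev := ev.toRingHom) hP
  have hQ := isSymm4_evQ (u := U) (ev := ev.toRingHom) hP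
  set γ := ev.toRingHom.mapMatrix G with hγ
  set T := evT P U ev.toRingHom with hTdef
  set Q := evQ P U ev.toRingHom with hQdef
  set X : ℝ := ∑ p, (γ * Matrix.of (T p)).trace * (γ * Matrix.of (T i)) p j with hX
  set S : ℝ := (γ * Matrix.of (T i) * (γ * Matrix.of (T j))).trace with hS
  have hH : ev.toRingHom.mapMatrix (frameHess P U) * γ = 1 := by
    rw [hγ, ← map_mul, mul_eq_one_comm.mp hG, map_one]
  have a1 : ∑ k, ev (P k (frameChristoffel G (frameHess P U) P k i j)) =
      1 / 2 * ((γ * Matrix.of (Q j i)).trace - X) := by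
    simp only [ev_derivation_frameChristoffel hG, ← Finset.mul_sum, Finset.sum_sub_distrib]
    rw [sum_mul_apply_self_four hQ, sum_mul_mul_apply_self hT]
  have a2 : ∑ k, ev (P j (frameChristoffel G (frameHess P U) P k i k)) =
      1 / 2 * ((γ * Matrix.of (Q j i)).trace - S) := by
    simp only [ev_derivation_frameChristoffel hG, ← Finset.mul_sum, Finset.sum_sub_distrib]
    rw [hS, Matrix.trace_mul_comm (γ * Matrix.of (T i))]
    rfl
  have a3 : ∑ k, ∑ p, ev (frameChristoffel G (frameHess P U) P k k p) *
      ev (frameChristoffel G (frameHess P U) P p i j) = 1 / 4 * X := by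
    simp only [ev_frameChristoffel, hX, ← sum_mul_apply_self (γ := γ) hT, Finset.sum_mul,
      Finset.mul_sum]
    rw [Finset.sum_comm]
    refine Finset.sum_congr rfl fun k _ => Finset.sum_congr rfl fun p _ => by ring
  have a4 : ∑ k, ∑ p, ev (frameChristoffel G (frameHess P U) P k j p) *
      ev (frameChristoffel G (frameHess P U) P p i k) = 1 / 4 * S := by
    simp only [ev_frameChristoffel]
    rw [hS, Matrix.trace_mul_comm]
    simp only [Matrix.trace, Matrix.diag_apply, Matrix.mul_apply (M := γ * _), Finset.mul_sum]
    refine Finset.sum_congr rfl fun k _ => Finset.sum_congr rfl fun p _ => by ring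
  have hW2 : ev (P i (P j W)) = 1 / 2 * ∑ p, ξ p * T i j p := by
    simp only [hW, Derivation.map_smul, map_smul, map_add, map_sum, Derivation.map_algebraMap,
      add_zero, smul_eq_mul]
    rfl
  have hW1 := ev_derivation_weight (ev := ev) hW hMA
  have a5 : ∑ k, ev (frameChristoffel G (frameHess P U) P k i j) * ev (P k W) =
      1 / 2 * ∑ p, ξ p * T i j p - 1 / 4 * X := by
    have e : ∀ p, ∑ k, ev (P k (P p U)) * (γ * Matrix.of (T i)) k j = T i j p := fun p => by
      have := congrArg (fun M => (M * Matrix.of (T i)) p j) hH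
      simp only [Matrix.mul_assoc, Matrix.one_mul] at this
      rw [Matrix.mul_apply, Matrix.of_apply] at this
      rw [hT.right i j p, ← this]
      refine Finset.sum_congr rfl fun k _ => ?_
      rw [hP k p]
      rfl
    simp only [ev_frameChristoffel, hW1, hX, ← e, Finset.mul_sum, mul_sub,
      Finset.sum_sub_distrib]
    congr 1
    · rw [Finset.sum_comm]
      refine Finset.sum_congr rfl fun k _ => Finset.sum_congr rfl fun p _ => by ring
    · refine Finset.sum_congr rfl fun k _ => by ring
  have hR : ev ((G * (frameHess P U).map (P i)) * (G * (frameHess P U).map (P j))).trace = S := by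
    rw [hS, hγ, hTdef, ← mapMatrix_hess_one, ← mapMatrix_hess_one, ← map_mul, ← map_mul,
      ← map_mul, ← ev_trace]
    rfl
  rw [hR]
  simp only [map_add, map_sub, map_sum, map_mul]
  rw [a1, a2, a3, a4, a5, hW2]
  ring

/-- The drift Laplacian of a solution of the weighted Monge–Ampère equation is
`G^{ij} ∂_i ∂_j - ξ^k ∂_k`. -/
lemma ev_driftLap (hP : ∀ a b f, P a (P b f) = P b (P a f)) (hG : G * frameHess P U = 1)
    {v ξ : Fin n → ℝ} {W : A}
    (hW : ∀ k, P k W = (1 / 2 : ℝ) • (∑ p, ξ p • P k (P p U) + algebraMap ℝ A (v k)))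
    (hMA : ∀ i, (G * (frameHess P U).map (P i)).trace =
      ∑ q, ξ q • P i (P q U) - algebraMap ℝ A (v i)) (F : A) :
    ev (∑ i, ∑ j, G i j * (P i (P j F)
        - ∑ k, frameChristoffel G (frameHess P U) P k i j * P k F)
      - ∑ i, ∑ j, G i j * P i W * P j F) =
    ev (∑ i, ∑ j, G i j * P i (P j F) - ∑ k, ξ k • P k F) := by
  have hT := isSymm3_evT (u := U) (ev := ev.toRingHom) hP
  set γ := ev.toRingHom.mapMatrix G with hγ
  set T := evT P U ev.toRingHom with hTdef
  have hγG : ∀ i j, ev (G i j) = γ i j := fun _ _ => rfl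
  have hGh : γ * ev.toRingHom.mapMatrix (frameHess P U) = 1 := by
    rw [hγ, ← map_mul, hG, map_one]
  have hsymm : γ.transpose = γ := by
    have hh : (ev.toRingHom.mapMatrix (frameHess P U)).transpose =
        ev.toRingHom.mapMatrix (frameHess P U) := by
      ext a b
      exact congrArg ev (hP b a U)
    rw [← hh] at hGh
    have h1 := congrArg Matrix.transpose hGh
    rw [Matrix.transpose_mul, Matrix.transpose_transpose, Matrix.transpose_one] at h1
    rw [hh] at hGh
    calc γ.transpose = γ * ev.toRingHom.mapMatrix (frameHess P U) * γ.transpose := by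
          rw [hGh, Matrix.one_mul]
      _ = γ := by rw [Matrix.mul_assoc, h1, Matrix.mul_one]
  have hcontr : ∀ k, ∑ i, ∑ j, γ i j * (γ * Matrix.of (T i)) k j =
      ∑ l, γ k l * (γ * Matrix.of (T l)).trace := fun k => by
    simp only [Matrix.mul_apply, Matrix.trace, Matrix.diag_apply, Matrix.of_apply,
      Finset.mul_sum]
    rw [Finset.sum_comm_cycle]
    refine Finset.sum_congr rfl fun l _ => Finset.sum_congr rfl fun i _ =>
      Finset.sum_congr rfl fun j _ => ?_
    rw [hT.left i l j, hT.right l i j]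
    ring
  have hweight : ∀ k, ∑ i, γ i k * ev (P i W) =
      ξ k - 1 / 2 * ∑ l, γ k l * (γ * Matrix.of (T l)).trace := fun k => by
    have e : ∀ p, ∑ i, γ k i * ev (P i (P p U)) = if k = p then 1 else 0 := fun p => by
      rw [← Matrix.one_apply, ← hGh, Matrix.mul_apply]
      rfl
    have e2 : ∑ i, γ k i * ∑ p, ξ p * ev (P i (P p U)) = ξ k := by
      simp only [Finset.mul_sum]
      rw [Finset.sum_comm]
      simp only [mul_left_comm _ (ξ _), ← Finset.mul_sum, e]
      simp
    simp only [ev_derivation_weight hW hMA, fun i => show γ i k = γ k i from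
      congrFun (congrFun hsymm k) i, mul_sub, Finset.sum_sub_distrib, e2]
    congr 1
    rw [Finset.mul_sum]
    exact Finset.sum_congr rfl fun l _ => by ring
  have hfirst : ∑ i, ∑ j, γ i j * ∑ k, 1 / 2 * (γ * Matrix.of (T i)) k j * ev (P k F) =
      ∑ k, 1 / 2 * (∑ l, γ k l * (γ * Matrix.of (T l)).trace) * ev (P k F) := by
    simp only [← hcontr, Finset.mul_sum, Finset.sum_mul]
    rw [Finset.sum_comm_cycle]
    refine Finset.sum_congr rfl fun k _ => Finset.sum_congr rfl fun i _ =>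
      Finset.sum_congr rfl fun j _ => by ring
  have hsecond : ∑ i, ∑ j, γ i j * ev (P i W) * ev (P j F) =
      ∑ k, (ξ k - 1 / 2 * ∑ l, γ k l * (γ * Matrix.of (T l)).trace) * ev (P k F) := by
    simp only [← hweight, Finset.sum_mul]
    exact Finset.sum_comm
  simp only [map_sub, map_sum, map_mul, map_smul, smul_eq_mul, hγG, ev_frameChristoffel, mul_sub,
    Finset.sum_sub_distrib]
  rw [hfirst, hsecond]
  simp only [sub_mul, Finset.sum_sub_distrib]
  ring

end Coordinates

section Frame

lemma sum_comm_pairs {ι M : Type*} [Fintype ι] [AddCommMonoid M] (f : ι → ι → ι → ι → M) :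
    ∑ a, ∑ b, ∑ i, ∑ j, f a b i j = ∑ i, ∑ j, ∑ a, ∑ b, f a b i j := by
  simpa only [Fintype.sum_prod_type] using Finset.sum_comm (s := Finset.univ)
    (t := Finset.univ) (f := fun (p q : ι × ι) => f p.1 p.2 q.1 q.2)

lemma derivation_sum_smul_apply {A : Type*} [CommRing A] [Algebra ℝ A]
    (P : Fin n → Derivation ℝ A A) (e : Fin n → ℝ) (f : A) :
    (∑ i, e i • P i) f = ∑ i, e i • P i f :=
  (congrFun (map_sum (Derivation.coeFnAddMonoidHom (R := ℝ) (A := A) (M := A))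
    (fun i => e i • P i) Finset.univ) f).trans (Finset.sum_apply ..)

open scoped MatrixOrder Matrix.Norms.L2Operator in
lemma exists_eq_mul_transpose {M : Matrix (Fin n) (Fin n) ℝ} (hM : M.PosDef) :
    ∃ E F : Matrix (Fin n) (Fin n) ℝ, E * F = 1 ∧ M = E * E.transpose := by
  obtain ⟨b, hb⟩ := CStarAlgebra.nonneg_iff_eq_star_mul_self.mp
    (Matrix.nonneg_iff_posSemidef.mpr hM.posSemidef)
  have hb' : M = b.transpose * b.transpose.transpose := by
    rw [hb, Matrix.transpose_transpose, Matrix.star_eq_conjTranspose,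
      Matrix.conjTranspose_eq_transpose_of_trivial]
  refine ⟨b.transpose, b.transpose⁻¹, Matrix.mul_nonsing_inv _ ?_, hb'⟩
  have := hM.det_pos
  rw [hb', Matrix.det_mul] at this
  exact isUnit_iff_ne_zero.mpr (left_ne_zero_of_mul this.ne')

variable {A : Type*} [CommRing A] [Algebra ℝ A]

/-- The frame with columns `E` with respect to the derivations `P`. -/
def frameOf (P : Fin n → Derivation ℝ A A) (E : Matrix (Fin n) (Fin n) ℝ) (a : Fin n) :
    Derivation ℝ A A :=
  ∑ i, E i a • P i

variable {P : Fin n → Derivation ℝ A A} {U : A} {G : Matrix (Fin n) (Fin n) A}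
  {E F : Matrix (Fin n) (Fin n) ℝ} {ev : A →ₐ[ℝ] ℝ}

lemma frameOf_apply (a : Fin n) (f : A) : frameOf P E a f = ∑ i, E i a • P i f :=
  derivation_sum_smul_apply P _ f

/-- The inclusion of real matrices into matrices over an algebra. -/
abbrev constMatrix (A : Type*) [CommRing A] [Algebra ℝ A] (E : Matrix (Fin n) (Fin n) ℝ) :
    Matrix (Fin n) (Fin n) A :=
  (algebraMap ℝ A).mapMatrix E

lemma constMatrix_transpose (E : Matrix (Fin n) (Fin n) ℝ) :
    constMatrix A E.transpose = (constMatrix A E).transpose := rfl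

lemma mapMatrix_constMatrix (E : Matrix (Fin n) (Fin n) ℝ) :
    ev.toRingHom.mapMatrix (constMatrix A E) = E := by
  ext i j
  exact ev.commutes (E i j)

lemma frameOf_apply_apply (a b : Fin n) (f : A) :
    frameOf P E a (frameOf P E b f) = ∑ i, ∑ j, (E i a * E j b) • P i (P j f) := by
  simp only [frameOf_apply, map_sum, Derivation.map_smul, Finset.smul_sum, smul_smul]
  rw [Finset.sum_comm]
  refine Finset.sum_congr rfl fun i _ => Finset.sum_congr rfl fun j _ => ?_
  rw [mul_comm]

lemma frameHess_frameOf : frameHess (frameOf P E) U =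
    (constMatrix A E).transpose * frameHess P U * constMatrix A E := by
  ext a b
  simp only [frameHess, Matrix.of_apply, frameOf_apply_apply, Matrix.mul_apply,
    Matrix.transpose_apply, RingHom.mapMatrix_apply, Matrix.map_apply, Finset.sum_mul]
  rw [Finset.sum_comm]
  refine Finset.sum_congr rfl fun i _ => Finset.sum_congr rfl fun j _ => ?_
  rw [Algebra.smul_def, map_mul]
  ring

lemma map_constMatrix (d : Derivation ℝ A A) (E : Matrix (Fin n) (Fin n) ℝ) :
    (constMatrix A E).map d = 0 := by
  ext i j
  exact d.map_algebraMap _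

lemma map_frameOf (M : Matrix (Fin n) (Fin n) A) (a : Fin n) :
    M.map (frameOf P E a) = ∑ i, E i a • M.map (P i) := by
  ext b c
  simp only [Matrix.map_apply, frameOf_apply, Matrix.sum_apply, Matrix.smul_apply]

lemma map_frameHess_frameOf (a : Fin n) : (frameHess (frameOf P E) U).map (frameOf P E a) =
    (constMatrix A E).transpose * (∑ i, E i a • (frameHess P U).map (P i)) * constMatrix A E := by
  rw [frameHess_frameOf, map_derivation_mul, map_derivation_mul, ← constMatrix_transpose,
    map_constMatrix, map_constMatrix, map_frameOf, Matrix.zero_mul, Matrix.mul_zero, zero_add,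
    add_zero]

/-- The inverse metric in the frame `frameOf P E`, where `F` is the inverse of `E`. -/
def frameInv (G : Matrix (Fin n) (Fin n) A) (F : Matrix (Fin n) (Fin n) ℝ) :
    Matrix (Fin n) (Fin n) A :=
  constMatrix A F * G * (constMatrix A F).transpose

lemma constMatrix_mul_eq_one (hEF : E * F = 1) : constMatrix A E * constMatrix A F = 1 := by
  rw [← map_mul, hEF, map_one]

lemma transpose_constMatrix_mul_eq_one (hEF : E * F = 1) :
    (constMatrix A F).transpose * (constMatrix A E).transpose = 1 := by
  rw [← Matrix.transpose_mul, constMatrix_mul_eq_one hEF, Matrix.transpose_one]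

lemma frameInv_mul (hEF : E * F = 1) (M : Matrix (Fin n) (Fin n) A) :
    frameInv G F * ((constMatrix A E).transpose * M * constMatrix A E) =
      constMatrix A F * (G * M) * constMatrix A E := by
  calc _ = constMatrix A F * G * ((constMatrix A F).transpose * (constMatrix A E).transpose)
        * M * constMatrix A E := by simp only [frameInv, Matrix.mul_assoc]
    _ = _ := by
      rw [transpose_constMatrix_mul_eq_one hEF, Matrix.mul_one, Matrix.mul_assoc (constMatrix A F)]

lemma frameInv_mul_frameHess (hEF : E * F = 1) (hG : G * frameHess P U = 1) :
    frameInv G F * frameHess (frameOf P E) U = 1 := by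
  rw [frameHess_frameOf, frameInv_mul hEF, hG, Matrix.mul_one,
    constMatrix_mul_eq_one (mul_eq_one_comm.mp hEF)]

lemma frameInv_mul_map (hEF : E * F = 1) (a : Fin n) :
    frameInv G F * (frameHess (frameOf P E) U).map (frameOf P E a) =
      constMatrix A F * (∑ i, E i a • (G * (frameHess P U).map (P i))) * constMatrix A E := by
  rw [map_frameHess_frameOf, frameInv_mul hEF, Matrix.mul_sum]
  simp only [Matrix.mul_smul]

lemma trace_const_conj (hEF : E * F = 1) (M : Matrix (Fin n) (Fin n) A) :
    (constMatrix A F * M * constMatrix A E).trace = M.trace := by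
  rw [Matrix.trace_mul_comm, ← Matrix.mul_assoc, constMatrix_mul_eq_one hEF, Matrix.one_mul]

lemma trace_frameInv_mul_map (hEF : E * F = 1) (a : Fin n) :
    (frameInv G F * (frameHess (frameOf P E) U).map (frameOf P E a)).trace =
      ∑ i, E i a • (G * (frameHess P U).map (P i)).trace := by
  rw [frameInv_mul_map hEF, trace_const_conj hEF, Matrix.trace_sum]
  simp only [Matrix.trace_smul]

lemma trace_frameInv_mul_map_mul (hEF : E * F = 1) (a b : Fin n) :
    (frameInv G F * (frameHess (frameOf P E) U).map (frameOf P E a) *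
      (frameInv G F * (frameHess (frameOf P E) U).map (frameOf P E b))).trace =
      ∑ i, ∑ j, (E i a * E j b) •
        ((G * (frameHess P U).map (P i)) * (G * (frameHess P U).map (P j))).trace := by
  rw [frameInv_mul_map hEF, frameInv_mul_map hEF]
  have h : ∀ M M' : Matrix (Fin n) (Fin n) A,
      constMatrix A F * M * constMatrix A E * (constMatrix A F * M' * constMatrix A E) =
        constMatrix A F * (M * M') * constMatrix A E := fun M M' => by
    calc _ = constMatrix A F * M * (constMatrix A E * constMatrix A F) * M' * constMatrix A E := by
          simp only [Matrix.mul_assoc]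
      _ = _ := by
        rw [constMatrix_mul_eq_one hEF, Matrix.mul_one, Matrix.mul_assoc (constMatrix A F)]
  rw [h, trace_const_conj hEF, Finset.sum_mul_sum, Matrix.trace_sum]
  refine Finset.sum_congr rfl fun i _ => ?_
  rw [Matrix.trace_sum]
  refine Finset.sum_congr rfl fun j _ => ?_
  rw [Matrix.smul_mul, Matrix.mul_smul, smul_smul, Matrix.trace_smul]

/-- The norm of the third derivatives does not depend on the frame. -/
lemma frameNorm_frameOf (hEF : E * F = 1) :
    frameNorm (frameInv G F) (frameHess (frameOf P E) U) (frameOf P E) =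
      frameNorm G (frameHess P U) P := by
  have h : ∀ i j, ∑ a, ∑ b, frameInv G F a b * algebraMap ℝ A (E i a * E j b) = G i j := by
    intro i j
    have h1 : constMatrix A E * frameInv G F * (constMatrix A E).transpose = G := by
      calc _ = (constMatrix A E * constMatrix A F) * G *
            ((constMatrix A F).transpose * (constMatrix A E).transpose) := by
            simp only [frameInv, Matrix.mul_assoc]
        _ = G := by
          rw [transpose_constMatrix_mul_eq_one hEF, constMatrix_mul_eq_one hEF, Matrix.one_mul,
            Matrix.mul_one]
    rw [← congrFun (congrFun h1 i) j]
    simp only [Matrix.mul_apply, Matrix.transpose_apply, RingHom.mapMatrix_apply,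
      Matrix.map_apply, Finset.sum_mul]
    rw [Finset.sum_comm]
    refine Finset.sum_congr rfl fun a _ => Finset.sum_congr rfl fun b _ => ?_
    rw [map_mul]
    ring
  simp only [frameNorm, trace_frameInv_mul_map_mul hEF, Finset.mul_sum, ← h, Finset.sum_mul]
  rw [sum_comm_pairs]
  refine Finset.sum_congr rfl fun i _ => Finset.sum_congr rfl fun j _ =>
    Finset.sum_congr rfl fun a _ => Finset.sum_congr rfl fun b _ => ?_
  rw [Algebra.smul_def]
  ring

/-- The Bochner-type lower bound for the squared norm of the third derivatives, in the coordinate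
frame. -/
lemma half_sum_le_drift_norm (hP : ∀ a b f, P a (P b f) = P b (P a f))
    (hG : G * frameHess P U = 1) {v ξ : Fin n → ℝ}
    (hMA : ∀ i, (G * (frameHess P U).map (P i)).trace =
      ∑ q, ξ q • P i (P q U) - algebraMap ℝ A (v i))
    (hpos : (ev.toRingHom.mapMatrix G).PosDef) :
    1 / 2 * ∑ i, ∑ p, ∑ j, ∑ q, ev (G i p) * ev (G j q)
      * ev ((G * (frameHess P U).map (P i)) * (G * (frameHess P U).map (P j))).trace
      * ev ((G * (frameHess P U).map (P p)) * (G * (frameHess P U).map (P q))).trace ≤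
    ev (∑ i, ∑ j, G i j * P i (P j (frameNorm G (frameHess P U) P))
      - ∑ k, ξ k • P k (frameNorm G (frameHess P U) P)) := by
  obtain ⟨E, F, hEF, hE⟩ := exists_eq_mul_transpose hpos
  have hE' : ∀ i j, ev (G i j) = ∑ a, E i a * E j a := fun i j =>
    congrFun (congrFun hE i) j
  have hFE := mul_eq_one_comm.mp hEF
  have hD : ∀ a b f, frameOf P E a (frameOf P E b f) = frameOf P E b (frameOf P E a f) := by
    intro a b f
    rw [frameOf_apply_apply, frameOf_apply_apply, Finset.sum_comm]
    refine Finset.sum_congr rfl fun i _ => Finset.sum_congr rfl fun j _ => ?_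
    rw [hP, mul_comm]
  have hZ : ∀ a f, frameOf P E a ((∑ k, ξ k • P k) f) = (∑ k, ξ k • P k) (frameOf P E a f) := by
    intro a f
    simp only [derivation_sum_smul_apply, frameOf_apply, map_sum, Derivation.map_smul,
      Finset.smul_sum]
    rw [Finset.sum_comm]
    refine Finset.sum_congr rfl fun i _ => Finset.sum_congr rfl fun j _ => ?_
    rw [hP, smul_comm]
  have hev : ev.toRingHom.mapMatrix (frameInv G F) = 1 := by
    rw [frameInv, map_mul, map_mul, ← constMatrix_transpose, mapMatrix_constMatrix,
      mapMatrix_constMatrix, hE, ← Matrix.mul_assoc, hFE, Matrix.one_mul, ← Matrix.transpose_mul,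
      hFE, Matrix.transpose_one]
  have key := half_normS_le_frameLap_norm hD hZ (frameInv_mul_frameHess hEF hG) hev
    (fun a b => by
      rw [trace_frameInv_mul_map hEF]
      simp only [hMA, smul_sub, Finset.sum_sub_distrib, map_sub, map_sum, Derivation.map_smul,
        Derivation.map_algebraMap, smul_zero, Finset.sum_const_zero, sub_zero,
        derivation_sum_smul_apply, frameOf_apply (f := U), Finset.smul_sum]
      exact Finset.sum_congr rfl fun i _ => Finset.sum_congr rfl fun j _ => by rw [hP])
  rw [frameNorm_frameOf hEF, frameLap_apply] at key
  set S : Fin n → Fin n → ℝ := fun i j =>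
    ev ((G * (frameHess P U).map (P i)) * (G * (frameHess P U).map (P j))).trace with hS
  have hT : ∀ a b, (Matrix.of (evT (frameOf P E) U ev.toRingHom a) *
      Matrix.of (evT (frameOf P E) U ev.toRingHom b)).trace =
      ∑ i, ∑ j, E i a * E j b * S i j := by
    intro a b
    have h := congrArg ev.toRingHom (trace_frameInv_mul_map_mul (G := G) (P := P) (U := U) hEF a b)
    rw [ev_trace, map_mul, map_mul, map_mul, hev, mapMatrix_hess_one, mapMatrix_hess_one,
      Matrix.one_mul, Matrix.one_mul] at h
    rw [h]
    change ev _ = _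
    simp only [map_sum, map_smul, smul_eq_mul, hS]
  have hnormS : normS (evT (frameOf P E) U ev.toRingHom) =
      ∑ i, ∑ p, ∑ j, ∑ q, ev (G i p) * ev (G j q) * S i j * S p q := by
    simp only [normS, hT, sq, hE', Finset.sum_mul_sum]
    simp only [Finset.sum_mul]
    refine sum_six_equiv ⟨fun (a, b, i, p, j, q) => (i, p, j, q, a, b),
      fun (i, p, j, q, a, b) => (a, b, i, p, j, q), fun _ => rfl, fun _ => rfl⟩
      fun a b i p j q => ?_
    simp only [Equiv.coe_fn_mk]
    ring
  rw [hnormS] at key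
  refine key.trans_eq ?_
  change ev _ = _
  simp only [map_sub, map_sum, frameOf_apply_apply, derivation_sum_smul_apply, map_mul, hE',
    map_smul, smul_eq_mul, Finset.sum_mul]
  congr 1
  rw [Finset.sum_comm]
  exact Finset.sum_congr rfl fun i _ => Finset.sum_comm

end Frame

section SmoothFunctions

open scoped ContDiff

variable {N : Set (Fin n → ℝ)}

lemma contDiffOn_pd (hN : IsOpen N) {F : (Fin n → ℝ) → ℝ} (hF : ContDiffOn ℝ ∞ F N)
    (i : Fin n) : ContDiffOn ℝ ∞ (pd i F) N :=
  (hF.fderiv_of_isOpen hN (m := ∞) (by simp)).clm_apply contDiffOn_const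

lemma eqOn_pd (hN : IsOpen N) {F F' : (Fin n → ℝ) → ℝ} (h : Set.EqOn F F' N) (i : Fin n) :
    Set.EqOn (pd i F) (pd i F') N := fun x hx => by
  rw [pd, pd, (h.eventuallyEq_of_mem (hN.mem_nhds hx)).fderiv_eq]

lemma differentiableAt_of_contDiffOn (hN : IsOpen N) {F : (Fin n → ℝ) → ℝ}
    (hF : ContDiffOn ℝ ∞ F N) {x : Fin n → ℝ} (hx : x ∈ N) : DifferentiableAt ℝ F x :=
  (hF.contDiffAt (hN.mem_nhds hx)).differentiableAt (by simp)

lemma pd_comm (hN : IsOpen N) {F : (Fin n → ℝ) → ℝ} (hF : ContDiffOn ℝ ∞ F N) (i j : Fin n) :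
    Set.EqOn (pd i (pd j F)) (pd j (pd i F)) N := fun x hx => by
  have hd : DifferentiableAt ℝ (fderiv ℝ F) x :=
    ((hF.fderiv_of_isOpen hN (m := ∞) (by simp)).contDiffAt (hN.mem_nhds hx)).differentiableAt
      (by simp)
  have h : ∀ k l : Fin n, pd k (pd l F) x =
      fderiv ℝ (fderiv ℝ F) x (Pi.single k 1) (Pi.single l 1) := fun k l => by
    change fderiv ℝ (fun y => fderiv ℝ F y (Pi.single l 1)) x (Pi.single k 1) = _
    rw [fderiv_clm_apply hd (differentiableAt_const _)]
    simp
  rw [h, h]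
  exact ((hF.contDiffAt (hN.mem_nhds hx)).isSymmSndFDerivAt
    (by rw [minSmoothness_of_isRCLikeNormedField]; exact ENat.LEInfty.out)).eq _ _

/-- The extension by zero of a function on `N`. -/
def zeroExt (f : N → ℝ) : (Fin n → ℝ) → ℝ := Function.extend Subtype.val f 0

lemma zeroExt_apply (f : N → ℝ) {x : Fin n → ℝ} (hx : x ∈ N) : zeroExt f x = f ⟨x, hx⟩ :=
  Subtype.val_injective.extend_apply f 0 ⟨x, hx⟩

variable (N) in
/-- The algebra of smooth functions on `N`. -/
def smoothAlg : Subalgebra ℝ (N → ℝ) where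
  carrier := {f | ContDiffOn ℝ ∞ (zeroExt f) N}
  mul_mem' {f g} hf hg := (hf.mul hg).congr fun x hx => by
    simp only [zeroExt_apply _ hx, Pi.mul_apply]
  add_mem' {f g} hf hg := (hf.add hg).congr fun x hx => by
    simp only [zeroExt_apply _ hx, Pi.add_apply]
  algebraMap_mem' r := (contDiffOn_const (c := r)).congr fun _ hx => by
    rw [zeroExt_apply _ hx]
    rfl

/-- `F` restricts to the element `f` of the algebra of smooth functions on `N`. -/
def Represents (F : (Fin n → ℝ) → ℝ) (f : smoothAlg N) : Prop :=
  ∀ x (hx : x ∈ N), F x = f.1 ⟨x, hx⟩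

lemma Represents.eqOn {F : (Fin n → ℝ) → ℝ} {f : smoothAlg N} (h : Represents F f) :
    Set.EqOn F (zeroExt f.1) N := fun x hx => by
  rw [h x hx, zeroExt_apply _ hx]

lemma exists_represents {F : (Fin n → ℝ) → ℝ} (hF : ContDiffOn ℝ ∞ F N) :
    ∃ f : smoothAlg N, Represents F f :=
  ⟨⟨fun x => F x, hF.congr fun _ hx => zeroExt_apply _ hx⟩, fun _ _ => rfl⟩

lemma Represents.unique {F : (Fin n → ℝ) → ℝ} {f g : smoothAlg N} (hf : Represents F f)
    (hg : Represents F g) : f = g :=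
  Subtype.ext (funext fun x => (hf x.1 x.2).symm.trans (hg x.1 x.2))

/-- The partial derivatives of smooth functions on `N`. -/
def smoothPd (hN : IsOpen N) (i : Fin n) : Derivation ℝ (smoothAlg N) (smoothAlg N) :=
  Derivation.mk'
    { toFun := fun f => ⟨fun x => pd i (zeroExt f.1) x,
        (contDiffOn_pd hN f.2 i).congr fun _ hx => zeroExt_apply _ hx⟩
      map_add' := fun f g => by
        ext x
        have h : Set.EqOn (zeroExt (f + g).1) (zeroExt f.1 + zeroExt g.1) N := fun y hy => by
          rw [Pi.add_apply, zeroExt_apply _ hy, zeroExt_apply _ hy, zeroExt_apply _ hy]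
          rfl
        change pd i _ x.1 = pd i _ x.1 + pd i _ x.1
        rw [eqOn_pd hN h i x.2, pd, fderiv_add (differentiableAt_of_contDiffOn hN f.2 x.2)
          (differentiableAt_of_contDiffOn hN g.2 x.2)]
        rfl
      map_smul' := fun r f => by
        ext x
        have h : Set.EqOn (zeroExt (r • f).1) (r • zeroExt f.1) N := fun y hy => by
          rw [Pi.smul_apply, zeroExt_apply _ hy, zeroExt_apply _ hy]
          rfl
        change pd i _ x.1 = r • pd i _ x.1
        rw [eqOn_pd hN h i x.2, pd,
          fderiv_const_smul (differentiableAt_of_contDiffOn hN f.2 x.2)]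
        rfl }
    fun f g => by
      ext x
      have h : Set.EqOn (zeroExt (f * g).1) (zeroExt f.1 * zeroExt g.1) N := fun y hy => by
        rw [Pi.mul_apply, zeroExt_apply _ hy, zeroExt_apply _ hy, zeroExt_apply _ hy]
        rfl
      change pd i _ x.1 = f.1 x * pd i _ x.1 + g.1 x * pd i _ x.1
      rw [eqOn_pd hN h i x.2, pd, fderiv_mul (differentiableAt_of_contDiffOn hN f.2 x.2)
        (differentiableAt_of_contDiffOn hN g.2 x.2), zeroExt_apply _ x.2, zeroExt_apply _ x.2]
      rfl

lemma Represents.pd (hN : IsOpen N) {F : (Fin n → ℝ) → ℝ} {f : smoothAlg N}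
    (h : Represents F f) (i : Fin n) : Represents (pd i F) (smoothPd hN i f) :=
  fun _ hx => eqOn_pd hN h.eqOn i hx

lemma smoothPd_comm (hN : IsOpen N) (i j : Fin n) (f : smoothAlg N) :
    smoothPd hN i (smoothPd hN j f) = smoothPd hN j (smoothPd hN i f) := by
  have hf : Represents (zeroExt f.1) f := fun _ hx => zeroExt_apply _ hx
  have h := (hf.pd hN j).pd hN i
  have h' := (hf.pd hN i).pd hN j
  exact Subtype.ext (funext fun x => (h x.1 x.2).symm.trans
    ((pd_comm hN f.2 i j x.2).trans (h' x.1 x.2)))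

/-- Evaluation of smooth functions on `N` at a point. -/
def smoothEval (x : N) : smoothAlg N →ₐ[ℝ] ℝ := (Pi.evalAlgHom ℝ (fun _ : N => ℝ) x).comp
  (smoothAlg N).val

lemma represents_iff {F : (Fin n → ℝ) → ℝ} {f : smoothAlg N} :
    Represents F f ↔ ∀ x : N, F x = smoothEval x f :=
  ⟨fun h x => h x.1 x.2, fun h x hx => h ⟨x, hx⟩⟩

end SmoothFunctions

section Assembly

open scoped ContDiff

variable {N : Set (Fin n → ℝ)} (hN : IsOpen N) {u : (Fin n → ℝ) → ℝ} {U : smoothAlg N}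
  {G : Matrix (Fin n) (Fin n) (smoothAlg N)}

lemma hessian_eq (hU : Represents u U) (x : N) :
    hessian u x = (smoothEval x).toRingHom.mapMatrix (frameHess (smoothPd hN) U) := by
  ext i j
  exact represents_iff.mp ((hU.pd hN j).pd hN i) x

lemma d3_eq (hU : Represents u U) (x : N) (i j k : Fin n) :
    d3 u i j k x = evT (smoothPd hN) U (smoothEval x).toRingHom i j k :=
  represents_iff.mp (((hU.pd hN k).pd hN j).pd hN i) x

lemma ginv_eq (hU : Represents u U) (hG : G * frameHess (smoothPd hN) U = 1) (x : N) :
    ginv u x = (smoothEval x).toRingHom.mapMatrix G := by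
  refine Matrix.inv_eq_left_inv ?_
  rw [hessian_eq hN hU, ← map_mul, hG, map_one]

lemma represents_christoffel (hU : Represents u U) (hG : G * frameHess (smoothPd hN) U = 1)
    (k i j : Fin n) : Represents (Christoffel u k i j)
      (frameChristoffel G (frameHess (smoothPd hN) U) (smoothPd hN) k i j) := by
  rw [represents_iff]
  intro x
  have hT := isSymm3_evT (u := U) (ev := (smoothEval x).toRingHom) (smoothPd_comm hN)
  rw [ev_frameChristoffel, Christoffel, Matrix.mul_apply, ← ginv_eq hN hU hG]
  refine congrArg _ (Finset.sum_congr rfl fun l _ => ?_)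
  rw [d3_eq hN hU, d3_eq hN hU, d3_eq hN hU, Matrix.of_apply, hT.left j i l, hT.left l i j,
    hT.right i j l]
  ring

lemma represents_norm3 (hU : Represents u U) (hG : G * frameHess (smoothPd hN) U = 1)
    (hpos : ∀ x ∈ N, (hessian u x).PosDef) :
    Represents (norm3 u) (frameNorm G (frameHess (smoothPd hN) U) (smoothPd hN)) := by
  rw [represents_iff]
  intro x
  have hT := isSymm3_evT (u := U) (ev := (smoothEval x).toRingHom) (smoothPd_comm hN)
  have hsymm : ∀ i j, ginv u x i j = ginv u x j i := fun i j =>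
    (hpos x x.2).inv.isHermitian.apply j i
  rw [ev_frameNorm, ← ginv_eq hN hU hG]
  simp only [norm3, d3_eq hN hU]
  exact sum_mul_trace_eq hsymm hT

variable {φ F : (Fin n → ℝ) → ℝ} {W f : smoothAlg N}

lemma covHess_eq (hU : Represents u U) (hG : G * frameHess (smoothPd hN) U = 1)
    (hf : Represents F f) (x : N) (i j : Fin n) : covHess u F i j x =
      smoothEval x (smoothPd hN i (smoothPd hN j f)
        - ∑ k, frameChristoffel G (frameHess (smoothPd hN) U) (smoothPd hN) k i j
          * smoothPd hN k f) := by
  simp only [covHess, map_sub, map_sum, map_mul,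
    represents_iff.mp ((hf.pd hN j).pd hN i) x, fun k => represents_iff.mp (hf.pd hN k) x,
    fun k => represents_iff.mp (represents_christoffel hN hU hG k i j) x]

lemma ricciPhi_eq (hU : Represents u U) (hG : G * frameHess (smoothPd hN) U = 1)
    (hφ : Represents φ W) {v ξ : Fin n → ℝ}
    (hW : ∀ k, smoothPd hN k W = (1 / 2 : ℝ) •
      (∑ p, ξ p • smoothPd hN k (smoothPd hN p U) + algebraMap ℝ (smoothAlg N) (v k)))
    (hMA : ∀ i, (G * (frameHess (smoothPd hN) U).map (smoothPd hN i)).trace =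
      ∑ q, ξ q • smoothPd hN i (smoothPd hN q U) - algebraMap ℝ (smoothAlg N) (v i))
    (x : N) (i j : Fin n) : ricciPhi u φ i j x =
      1 / 4 * smoothEval x ((G * (frameHess (smoothPd hN) U).map (smoothPd hN i)) *
        (G * (frameHess (smoothPd hN) U).map (smoothPd hN j))).trace := by
  rw [← ev_ricciPhi (smoothPd_comm hN) hG hW hMA, map_add, ricciPhi, covHess_eq hN hU hG hφ]
  simp only [Ricci, map_add, map_sub, map_sum, map_mul,
    fun k i j => represents_iff.mp (represents_christoffel hN hU hG k i j) x,
    fun l k i j => represents_iff.mp ((represents_christoffel hN hU hG k i j).pd hN l) x]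

lemma driftLap_eq (hU : Represents u U) (hG : G * frameHess (smoothPd hN) U = 1)
    (hφ : Represents φ W) (hf : Represents F f) {v ξ : Fin n → ℝ}
    (hW : ∀ k, smoothPd hN k W = (1 / 2 : ℝ) •
      (∑ p, ξ p • smoothPd hN k (smoothPd hN p U) + algebraMap ℝ (smoothAlg N) (v k)))
    (hMA : ∀ i, (G * (frameHess (smoothPd hN) U).map (smoothPd hN i)).trace =
      ∑ q, ξ q • smoothPd hN i (smoothPd hN q U) - algebraMap ℝ (smoothAlg N) (v i))
    (x : N) : driftLap u φ F x = smoothEval x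
      (∑ i, ∑ j, G i j * smoothPd hN i (smoothPd hN j f) - ∑ k, ξ k • smoothPd hN k f) := by
  have hγ : ∀ i j, ginv u x i j = smoothEval x (G i j) := fun i j => by
    rw [ginv_eq hN hU hG]
    rfl
  rw [← ev_driftLap (smoothPd_comm hN) hG hW hMA]
  simp only [driftLap, laplacian, covHess_eq hN hU hG hf, map_sub, map_sum, map_mul, hγ,
    fun k => represents_iff.mp (hf.pd hN k) x, fun k => represents_iff.mp (hφ.pd hN k) x]

lemma exists_inverse (hU : Represents u U) (hpos : ∀ x ∈ N, (hessian u x).PosDef) :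
    ∃ d : smoothAlg N, d * (frameHess (smoothPd hN) U).det = 1 := by
  have hdet : Represents (fun x => (hessian u x).det) (frameHess (smoothPd hN) U).det :=
    represents_iff.mpr fun x => by
      rw [hessian_eq hN hU]
      exact (RingHom.map_det _ _).symm
  have hsmooth : ContDiffOn ℝ ∞ (fun x => (hessian u x).det) N :=
    (frameHess (smoothPd hN) U).det.2.congr hdet.eqOn
  obtain ⟨d, hd⟩ := exists_represents (hsmooth.inv fun x hx => (hpos x hx).det_pos.ne')
  refine ⟨d, Subtype.ext (funext fun x => ?_)⟩
  change d.1 x * (frameHess (smoothPd hN) U).det.1 x = 1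
  rw [← hd x.1 x.2, ← hdet x.1 x.2]
  exact inv_mul_cancel₀ (hpos x x.2).det_pos.ne'

lemma exists_coordinate (p : Fin n) : ∃ X : smoothAlg N, Represents (fun x => x p) X ∧
    ∀ i, smoothPd hN i X = algebraMap ℝ (smoothAlg N) (if p = i then 1 else 0) := by
  obtain ⟨X, hX⟩ := exists_represents (N := N) (contDiff_apply ℝ ℝ p).contDiffOn
  refine ⟨X, hX, fun i => (hX.pd hN i).unique fun x hx => ?_⟩
  have h : HasFDerivAt (fun y : Fin n → ℝ => y p) (ContinuousLinearMap.proj (R := ℝ) p) x :=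
    (ContinuousLinearMap.proj (R := ℝ) (φ := fun _ : Fin n => ℝ) p).hasFDerivAt
  rw [pd, h.fderiv]
  exact Pi.single_apply i (1 : ℝ) p

lemma trace_log_eq (hU : Represents u U) (hpos : ∀ x ∈ N, (hessian u x).PosDef)
    {v ξ : Fin n → ℝ} {c : ℝ} (hMA : MAeq u N v ξ c)
    (hG : G * frameHess (smoothPd hN) U = 1) (i : Fin n) :
    (G * (frameHess (smoothPd hN) U).map (smoothPd hN i)).trace =
      ∑ q, ξ q • smoothPd hN i (smoothPd hN q U) - algebraMap ℝ (smoothAlg N) (v i) := by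
  choose X hX hdX using exists_coordinate (N := N) hN
  set H := frameHess (smoothPd hN) U with hH
  have hdet : Represents (fun x => (hessian u x).det) H.det :=
    represents_iff.mpr fun x => by
      rw [hessian_eq hN hU]
      exact (RingHom.map_det _ _).symm
  set r : smoothAlg N := -(∑ p, v p • X p) + ∑ q, ξ q • smoothPd hN q U
    + algebraMap ℝ (smoothAlg N) c with hr
  have hrep : Represents (fun x => Real.log (hessian u x).det) r :=
    represents_iff.mpr fun x => by
      rw [hMA x x.2, hr]
      simp only [map_add, map_neg, map_sum, map_smul, AlgHom.commutes, smul_eq_mul,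
        ← represents_iff.mp (hX _) x, ← represents_iff.mp (hU.pd hN _) x, mul_comm (ξ _)]
      rfl
  have hdr : smoothPd hN i r =
      ∑ q, ξ q • smoothPd hN i (smoothPd hN q U) - algebraMap ℝ (smoothAlg N) (v i) := by
    simp only [hr, map_add, map_neg, map_sum, Derivation.map_smul, Derivation.map_algebraMap,
      hdX, add_zero]
    rw [sub_eq_neg_add]
    congr 2
    simp [Algebra.smul_def]
  have hlog : smoothPd hN i H.det = H.det * smoothPd hN i r := by
    refine Subtype.ext (funext fun x => ?_)
    change _ = H.det.1 x * (smoothPd hN i r).1 x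
    rw [← (hrep.pd hN i) x.1 x.2, ← (hdet.pd hN i) x.1 x.2, ← hdet x.1 x.2]
    have hdiff : DifferentiableAt ℝ (fun y => (hessian u y).det) x.1 :=
      differentiableAt_of_contDiffOn hN (H.det.2.congr hdet.eqOn) x.2
    have hne := (hpos x x.2).det_pos.ne'
    rw [pd, pd, fderiv.log hdiff hne]
    simp only [smul_apply, smul_eq_mul]
    field_simp
  have hadj : H.adjugate = H.det • G := by
    calc H.adjugate = G * H * H.adjugate := by rw [hG, Matrix.one_mul]
      _ = H.det • G := by rw [Matrix.mul_assoc, Matrix.mul_adjugate, Matrix.mul_smul, Matrix.mul_one]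
  obtain ⟨d, hd⟩ := exists_inverse hN hU hpos
  rw [derivation_det, hadj, Matrix.smul_mul, Matrix.trace_smul, smul_eq_mul] at hlog
  rw [← hdr]
  calc _ = d * H.det * (G * H.map (smoothPd hN i)).trace := by rw [hd, one_mul]
    _ = d * H.det * smoothPd hN i r := by rw [mul_assoc, hlog, mul_assoc]
    _ = _ := by rw [hd, one_mul]

lemma exists_represents_weight (hU : Represents u U) (ξ v : Fin n → ℝ) :
    ∃ W : smoothAlg N, Represents (weight u ξ v) W ∧
      ∀ k, smoothPd hN k W = (1 / 2 : ℝ) •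
        (∑ p, ξ p • smoothPd hN k (smoothPd hN p U) + algebraMap ℝ (smoothAlg N) (v k)) := by
  choose X hX hdX using exists_coordinate (N := N) hN
  refine ⟨(1 / 2 : ℝ) • (∑ p, ξ p • smoothPd hN p U + ∑ q, v q • X q),
    represents_iff.mpr fun x => ?_, fun k => ?_⟩
  · simp only [weight, map_add, map_sum, map_smul, smul_eq_mul,
      ← represents_iff.mp (hX _) x, ← represents_iff.mp (hU.pd hN _) x, mul_comm (ξ _)]
  · simp only [map_add, map_sum, Derivation.map_smul, hdX]
    congr 2
    simp [Algebra.smul_def]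

end Assembly

theorem bochner_lower_bound {n : ℕ} (hn : 1 ≤ n) (N : Set (Fin n → ℝ)) (hNopen : IsOpen N)
    (hNne : N.Nonempty) (u : (Fin n → ℝ) → ℝ) (hu : ContDiffOn ℝ (⊤ : ℕ∞) u N)
    (hpos : ∀ x ∈ N, (hessian u x).PosDef)
    (v ξ : Fin n → ℝ) (c : ℝ) (hMA : MAeq u N v ξ c) :
    ∀ x ∈ N,
      driftLap u (weight u ξ v) (norm3 u) x ≥
        8 * ∑ i, ∑ p, ∑ j, ∑ q, ginv u x i p * ginv u x j q *
          ricciPhi u (weight u ξ v) i j x * ricciPhi u (weight u ξ v) p q x := by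
  intro x hx
  obtain ⟨U, hU⟩ := exists_represents hu
  obtain ⟨d, hd⟩ := exists_inverse hNopen hU hpos
  have hG : (d • (frameHess (smoothPd hNopen) U).adjugate) * frameHess (smoothPd hNopen) U = 1 := by
    rw [Matrix.smul_mul, Matrix.adjugate_mul, smul_smul, hd, one_smul]
  obtain ⟨W, hφ, hW⟩ := exists_represents_weight hNopen hU ξ v
  have htr := trace_log_eq hNopen hU hpos hMA hG
  have hγ := ginv_eq hNopen hU hG ⟨x, hx⟩
  have key := half_sum_le_drift_norm (ev := smoothEval ⟨x, hx⟩) (smoothPd_comm hNopen) hG htr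
    (hγ ▸ (hpos x hx).inv)
  rw [← driftLap_eq hNopen hU hG hφ (represents_norm3 hNopen hU hG hpos) hW htr ⟨x, hx⟩] at key
  refine ge_iff_le.mpr (le_trans (le_of_eq ?_) key)
  simp only [Finset.mul_sum]
  refine Finset.sum_congr rfl fun i _ => Finset.sum_congr rfl fun p _ =>
    Finset.sum_congr rfl fun j _ => Finset.sum_congr rfl fun q _ => ?_
  rw [ricciPhi_eq hNopen hU hG hφ hW htr ⟨x, hx⟩, ricciPhi_eq hNopen hU hG hφ hW htr ⟨x, hx⟩, hγ]
  simp only [RingHom.mapMatrix_apply, Matrix.map_apply, AlgHom.toRingHom_eq_coe, RingHom.coe_coe]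
  ring

end KRS
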